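/- arXiv:0812.4244 — 2 statements merged into one kernel-verified Lean document; each statement's English description precedes it below -/
import Mathlib

section
/- Under the hypotheses of the preceding approximation setting — Ω ⊂ ℝ² bounded, open, simply connected; (Ω, ψ) satisfying the bounded slope condition; f with α(ρ) := ρ f''(ρ)/f'(ρ) having a finite limit at 0⁺ (and α(0) := 0) and a positive limit at +∞; (fₐ) strictly convex, C¹ on [0,∞), C² on (0,∞), f'ₐ(0) = 0, f'ₐ strictly increasing onto [0,∞) with inverse g'ₐ, converging uniformly to f; αₐ := ρf''ₐ/f'ₐ with positive limits at 0⁺; uₐ the Lipschitz minimizers of Jₐ with boundary ψ and vₐ their zero-mean stream functions — suppose in addition that αₐ converges to α uniformly on every compact subset of [0,∞). Then (vₐ) contains a subsequence converging uniformly on Ω to a function v which is a viscosity solution in Ω of −[1 − α(g'(‖∇v‖))]·Δ∞v − ‖∇v‖²·α(g'(‖∇v‖))·Δv = 0, where g(r) = sup{rρ − f(ρ) : ρ ≥ 0} and g' is its derivative. -/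
open Set MeasureTheory Metric Filter
open scoped RealInnerProductSpace Topology Classical

noncomputable section

abbrev E2 := EuclideanSpace ℝ (Fin 2)

/-- A function is Lipschitz on a set (with some constant). -/
def LipOn (w : E2 → ℝ) (s : Set E2) : Prop := ∃ L : NNReal, LipschitzOnWith L w s

/-- The functional `J(w) = ∫_Ω f(‖∇w‖)`, with `∇w` the a.e.-defined (Rademacher) gradient,
extended by the junk value `0` where `w` is not differentiable. -/
def J (f : ℝ → ℝ) (Ω : Set E2) (w : E2 → ℝ) : ℝ := ∫ x in Ω, f ‖gradient w x‖

/-- The (one-sided at `0`) derivative of `f` on `[0,∞)`. -/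
def dtop (f : ℝ → ℝ) : ℝ → ℝ := derivWithin f (Set.Ici 0)

/-- Standing assumptions on the Lagrangian `f` : strictly convex on `[0,∞)`, `C¹` on `[0,∞)`,
`C²` on `(0,∞)` with `f''` locally Hölder continuous of some exponent `λ ∈ (0,1)`,
and `f'(0) > 0`. -/
def StdF (f : ℝ → ℝ) : Prop :=
  StrictConvexOn ℝ (Set.Ici 0) f ∧ ContDiffOn ℝ 1 f (Set.Ici 0) ∧
  ContDiffOn ℝ 2 f (Set.Ioi 0) ∧
  (∃ lam : NNReal, 0 < lam ∧ lam < 1 ∧ ∀ K : Set ℝ, IsCompact K → K ⊆ Set.Ioi 0 →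
    ∃ C : NNReal, HolderOnWith C lam (deriv (dtop f)) K) ∧
  0 < dtop f 0

/-- `u` solves the variational problem (P): `u` is Lipschitz on the closure of `Ω`,
`u = ψ` on `∂Ω`, and `u` minimizes `J` among such functions. -/
def SolvesP (f : ℝ → ℝ) (Ω : Set E2) (ψ : E2 → ℝ) (u : E2 → ℝ) : Prop :=
  LipOn u (closure Ω) ∧ EqOn u ψ (frontier Ω) ∧
  ∀ w : E2 → ℝ, LipOn w (closure Ω) → EqOn w ψ (frontier Ω) → J f Ω u ≤ J f Ω w

/-- `u` has an isolated critical point in `Ω`. -/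
def HasIsolatedCritPt (Ω : Set E2) (u : E2 → ℝ) : Prop :=
  ∃ z₀ ∈ Ω, ∃ r > (0:ℝ), gradient u z₀ = 0 ∧
    ∀ z ∈ Ω, z ≠ z₀ → dist z z₀ < r → gradient u z ≠ 0

/-- `v` is a zero-mean stream function for `u` on `Ω` (relative to the Lagrangian derivative
`f'`): `v` is Lipschitz on `Ω`, has zero mean on `Ω`, and satisfies almost everywhere in `Ω`
`∂ₓv = −f'(‖∇u‖)∂ᵧu/‖∇u‖`, `∂ᵧv = f'(‖∇u‖)∂ₓu/‖∇u‖` (right-hand sides taken to be `0`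
where `∇u = 0`). -/
def IsStreamFn (f' : ℝ → ℝ) (Ω : Set E2) (u v : E2 → ℝ) : Prop :=
  LipOn v Ω ∧ (∫ z in Ω, v z) = 0 ∧
  ∀ᵐ z ∂(volume.restrict Ω),
    gradient v z 0 = (if gradient u z = 0 then 0
      else -(f' ‖gradient u z‖ * gradient u z 1 / ‖gradient u z‖)) ∧
    gradient v z 1 = (if gradient u z = 0 then 0
      else f' ‖gradient u z‖ * gradient u z 0 / ‖gradient u z‖)

/-- `(Ω, ψ)` satisfies the bounded slope condition with constant `Q`. -/
def BSC (Ω : Set E2) (ψ : E2 → ℝ) (Q : ℝ) : Prop :=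
  ∀ x₀ ∈ frontier Ω, ∃ a b : E2, ∃ c d : ℝ,
    ‖a‖ ≤ Q ∧ ‖b‖ ≤ Q ∧
    (∀ x ∈ frontier Ω, ⟪a, x⟫ + c ≤ ψ x ∧ ψ x ≤ ⟪b, x⟫ + d) ∧
    ⟪a, x₀⟫ + c = ψ x₀ ∧ ⟪b, x₀⟫ + d = ψ x₀

/-- The Fenchel conjugate of `f`: `g(r) = sup {ρr − f(ρ) : ρ ≥ 0}`. -/
def fenchel (f : ℝ → ℝ) (r : ℝ) : ℝ := sSup ((fun ρ => ρ * r - f ρ) '' Set.Ici 0)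

/-- `w` is a viscosity solution of `F(∇w, ∇²w) = 0` in `Ω ⊆ ℝ²`. -/
def ViscositySol (Ω : Set E2) (F : E2 → (E2 →L[ℝ] E2) → ℝ) (w : E2 → ℝ) : Prop :=
  ContinuousOn w Ω ∧
  (∀ x ∈ Ω, ∀ φ : E2 → ℝ, ContDiff ℝ 2 φ →
    IsLocalMaxOn (fun y => w y - φ y) Ω x →
    F (gradient φ x) (fderiv ℝ (gradient φ) x) ≤ 0) ∧
  (∀ x ∈ Ω, ∀ φ : E2 → ℝ, ContDiff ℝ 2 φ →
    IsLocalMinOn (fun y => w y - φ y) Ω x →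
    0 ≤ F (gradient φ x) (fderiv ℝ (gradient φ) x))


/-! ### Lipschitz functions and their gradients -/

theorem norm_gradient_eq (w : E2 → ℝ) (x : E2) : ‖gradient w x‖ = ‖fderiv ℝ w x‖ := by
  simp [gradient]

theorem gradient_add_of_differentiableAt {u w : E2 → ℝ} {x : E2} (hu : DifferentiableAt ℝ u x)
    (hw : DifferentiableAt ℝ w x) :
    gradient (fun y => u y + w y) x = gradient u x + gradient w x := by
  simp [gradient, fderiv_fun_add hu hw]

theorem gradient_sub_of_differentiableAt {u w : E2 → ℝ} {x : E2} (hu : DifferentiableAt ℝ u x)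
    (hw : DifferentiableAt ℝ w x) :
    gradient (fun y => u y - w y) x = gradient u x - gradient w x := by
  simp [gradient, fderiv_fun_sub hu hw]

theorem gradient_const_mul_of_differentiableAt {u : E2 → ℝ} {x : E2}
    (hu : DifferentiableAt ℝ u x) (c : ℝ) :
    gradient (fun y => c * u y) x = c • gradient u x := by
  simp [gradient, fderiv_const_mul hu]

theorem gradient_neg_apply (u : E2 → ℝ) (x : E2) :
    gradient (fun y => -u y) x = -gradient u x := by
  simp [gradient, fderiv_fun_neg]

theorem gradient_sub_const (u : E2 → ℝ) (c : ℝ) (x : E2) :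
    gradient (fun y => u y - c) x = gradient u x := by
  simp [gradient, fderiv_sub_const]

theorem gradient_add_const (u : E2 → ℝ) (c : ℝ) (x : E2) :
    gradient (fun y => u y + c) x = gradient u x := by
  simp [gradient, fderiv_add_const]

theorem differentiableAt_inner_const_left (b x : E2) :
    DifferentiableAt ℝ (fun y : E2 => ⟪b, y⟫) x :=
  (innerSL ℝ b).differentiableAt

theorem gradient_inner_const_left (b x : E2) : gradient (fun y : E2 => ⟪b, y⟫) x = b := by
  have h : HasFDerivAt (fun y : E2 => ⟪b, y⟫) (innerSL ℝ b) x := (innerSL ℝ b).hasFDerivAt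
  refine HasGradientAt.gradient ?_
  rw [hasGradientAt_iff_hasFDerivAt]
  exact h

theorem gradient_comp_add_right (u : E2 → ℝ) (a x : E2) :
    gradient (fun y => u (y + a)) x = gradient u (x + a) := by
  simp [gradient, fderiv_comp_add_right]

theorem measurable_gradient (w : E2 → ℝ) : Measurable (gradient w) :=
  (InnerProductSpace.toDual ℝ E2).symm.continuous.measurable.comp (measurable_fderiv ℝ w)

theorem IsLocalMin.gradient_eq_zero {w : E2 → ℝ} {x : E2} (h : IsLocalMin w x) :
    gradient w x = 0 := by
  simp [gradient, h.fderiv_eq_zero]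

theorem gradient_eq_zero_of_nonneg {k : E2 → ℝ} (hk : ∀ x, 0 ≤ k x) {x : E2} (hx : k x = 0) :
    gradient k x = 0 :=
  IsLocalMin.gradient_eq_zero (Eventually.of_forall fun y => by simpa [hx] using hk y)

theorem LipschitzWith.norm_gradient_le {C : NNReal} {w : E2 → ℝ} (hw : LipschitzWith C w) (x : E2) :
    ‖gradient w x‖ ≤ C := by
  rw [norm_gradient_eq]; exact norm_fderiv_le_of_lipschitz ℝ hw

theorem IsPreconnected.exists_mem_frontier {X : Type*} [TopologicalSpace X] {s D : Set X}
    (hs : IsPreconnected s) {x y : X} (hx : x ∈ s) (hxD : x ∈ D) (hy : y ∈ s) (hyD : y ∉ D) :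
    ∃ z ∈ s, z ∈ frontier D := by
  by_contra! hne
  have hsub := hs.subset_or_subset (u := interior D) (v := (closure D)ᶜ) isOpen_interior
    isClosed_closure.isOpen_compl
    (Set.disjoint_left.2 fun a ha hb => hb (subset_closure (interior_subset ha)))
    (fun a ha => by
      by_cases h1 : a ∈ closure D
      · left
        by_contra h2
        exact hne a ha ⟨h1, h2⟩
      · exact Or.inr h1)
  rcases hsub with h | h
  · exact hyD (interior_subset (h hy))
  · exact h hx (subset_closure hxD)

theorem LipschitzWith.indicator_of_frontier {C : NNReal} {H : E2 → ℝ} {D : Set E2}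
    (hH : LipschitzWith C H) (h0 : ∀ x ∈ frontier D, H x = 0) :
    LipschitzWith C (D.indicator H) := by
  have key : ∀ x ∈ D, ∀ y ∉ D, |H x| ≤ C * dist x y := by
    intro x hx y hy
    have hconn : IsPreconnected (segment ℝ x y) := (convex_segment x y).isPreconnected
    obtain ⟨z, hz, hzf⟩ := hconn.exists_mem_frontier (left_mem_segment ℝ x y) hx
      (right_mem_segment ℝ x y) hy
    have h1 := hH.dist_le_mul x z
    rw [h0 z hzf, Real.dist_eq, sub_zero] at h1
    have h2 : dist x z ≤ dist x y := by
      have := dist_add_dist_of_mem_segment hz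
      linarith [dist_nonneg (x := z) (y := y)]
    exact h1.trans (by gcongr)
  refine LipschitzWith.of_dist_le_mul fun x y => ?_
  by_cases hx : x ∈ D <;> by_cases hy : y ∈ D
  · simpa [hx, hy] using hH.dist_le_mul x y
  · simpa [hx, hy, Real.dist_eq] using key x hx y hy
  · rw [dist_comm x y]
    simpa [hx, hy, Real.dist_eq] using key y hy x hx
  · simp [hx, hy]; positivity

theorem integral_fderiv_mul_eq_neg {C D : NNReal} {f g : E2 → ℝ} (hf : LipschitzWith C f)
    (hg : LipschitzWith D g) (h'g : HasCompactSupport g) (e : E2) :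
    ∫ x, fderiv ℝ f x e * g x = -∫ x, f x * fderiv ℝ g x e := by
  have h1 := hf.integral_lineDeriv_mul_eq (μ := volume) hg h'g e
  have h2 : ∫ x, lineDeriv ℝ f x e * g x = ∫ x, fderiv ℝ f x e * g x := by
    refine integral_congr_ae ?_
    filter_upwards [hf.ae_differentiableAt] with x hx
    rw [hx.lineDeriv_eq_fderiv]
  have h3 : ∫ x, lineDeriv ℝ g x (-e) * f x = -∫ x, f x * fderiv ℝ g x e := by
    rw [← integral_neg]
    refine integral_congr_ae ?_
    filter_upwards [hg.ae_differentiableAt] with x hx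
    rw [hx.lineDeriv_eq_fderiv, map_neg]; ring
  rw [← h2, h1, h3]

theorem integral_fderiv_eq_zero {D : NNReal} {g : E2 → ℝ}
    (hg : LipschitzWith D g) (h'g : HasCompactSupport g) (e : E2) :
    ∫ x, fderiv ℝ g x e = 0 := by
  have h := integral_fderiv_mul_eq_neg (LipschitzWith.const (1 : ℝ)) hg h'g e
  simpa using h

theorem measurable_fderiv_apply (f : E2 → ℝ) (e : E2) : Measurable fun x => fderiv ℝ f x e :=
  measurable_fderiv_apply_const ℝ f e

theorem integrable_fderiv {D : NNReal} {g : E2 → ℝ}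
    (hg : LipschitzWith D g) (h'g : HasCompactSupport g) (e : E2) :
    Integrable fun x => fderiv ℝ g x e := by
  have hb : ∀ x, ‖fderiv ℝ g x e‖ ≤ D * ‖e‖ := fun x =>
    (ContinuousLinearMap.le_opNorm _ _).trans (by gcongr; exact norm_fderiv_le_of_lipschitz ℝ hg)
  have hs : Function.support (fun x => fderiv ℝ g x e) ⊆ tsupport g := fun x hx => by
    by_contra h
    have : fderiv ℝ g x = 0 := image_eq_zero_of_notMem_tsupport
      (fun h' => h (tsupport_fderiv_subset ℝ h'))
    simp [this] at hx
  rw [← integrableOn_iff_integrable_of_support_subset hs]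
  exact Measure.integrableOn_of_bounded (IsCompact.measure_lt_top h'g).ne
    (measurable_fderiv_apply g e).aestronglyMeasurable (Eventually.of_forall hb)

theorem integrable_bdd_mul_fderiv {D : NNReal} {C : ℝ} {g k : E2 → ℝ}
    (hg : LipschitzWith D g) (h'g : HasCompactSupport g) (hk : Measurable k)
    (hb : ∀ x, ‖k x‖ ≤ C) (e : E2) :
    Integrable fun x => k x * fderiv ℝ g x e :=
  (integrable_fderiv hg h'g e).bdd_mul hk.aestronglyMeasurable (Eventually.of_forall hb)

/-- Mixed second derivatives commute, in the weak sense. -/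
theorem integral_fderiv_mul_fderiv_comm {C D : NNReal} {u k : E2 → ℝ} (hu : LipschitzWith C u)
    (hk : LipschitzWith D k) (hkc : HasCompactSupport k) (a b : E2) :
    ∫ x, fderiv ℝ u x a * fderiv ℝ k x b = ∫ x, fderiv ℝ u x b * fderiv ℝ k x a := by
  have hub : ∀ x, ‖fderiv ℝ u x b‖ ≤ C * ‖b‖ := fun x =>
    (ContinuousLinearMap.le_opNorm _ _).trans (by gcongr; exact norm_fderiv_le_of_lipschitz ℝ hu)
  have hkI : Integrable k := hk.continuous.integrable_of_hasCompactSupport hkc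
  -- the difference quotient in direction `a`
  have h1 := hu.integral_inv_smul_sub_mul_tendsto_integral_lineDeriv_mul (μ := volume)
    (integrable_fderiv hk hkc b) a
  set K : Set E2 := cthickening ‖a‖ (tsupport k) with hK
  have hKc : IsCompact K := IsCompact.cthickening hkc
  have hgI : Integrable (K.indicator fun x => fderiv ℝ u x b) := by
    rw [integrable_indicator_iff hKc.measurableSet]
    exact Measure.integrableOn_of_bounded hKc.measure_lt_top.ne
      (measurable_fderiv_apply u b).aestronglyMeasurable (Eventually.of_forall hub)
  have h2 := hk.integral_inv_smul_sub_mul_tendsto_integral_lineDeriv_mul (μ := volume) hgI (-a)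
  have h3 : ∀ᶠ t in 𝓝[>] (0:ℝ), ∫ x, (t⁻¹ • (u (x + t • a) - u x)) * fderiv ℝ k x b
      = -∫ x, (t⁻¹ • (k (x + t • (-a)) - k x)) * K.indicator (fun x => fderiv ℝ u x b) x := by
    have hlt : ∀ᶠ t in 𝓝[>] (0:ℝ), t < 1 := mem_nhdsWithin_of_mem_nhds (Iio_mem_nhds one_pos)
    filter_upwards [self_mem_nhdsWithin, hlt] with t ht0 ht1
    have ht0 : 0 < t := ht0
    obtain ⟨C', hC'⟩ : ∃ C', LipschitzWith C' fun x => t⁻¹ • (u (x + t • a) - u x) := by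
      have e1 : LipschitzWith C (fun x => u (x + t • a)) := by
        have := hu.comp (isometry_add_right (t • a)).lipschitz
        rwa [mul_one] at this
      exact ⟨_, (lipschitzWith_smul t⁻¹).comp (e1.sub hu)⟩
    have e2 := integral_fderiv_mul_eq_neg hC' hk hkc b
    have e3 : ∫ x, (t⁻¹ • (u (x + t • a) - u x)) * fderiv ℝ k x b
        = -∫ x, fderiv ℝ (fun x => t⁻¹ • (u (x + t • a) - u x)) x b * k x := by
      rw [e2, neg_neg]
    have e4 : ∫ x, fderiv ℝ (fun x => t⁻¹ • (u (x + t • a) - u x)) x b * k x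
        = ∫ x, (t⁻¹ * (fderiv ℝ u (x + t • a) b * k x) - t⁻¹ * (fderiv ℝ u x b * k x)) := by
      refine integral_congr_ae ?_
      have hd := hu.ae_differentiableAt (μ := volume)
      have hd' : ∀ᵐ x, DifferentiableAt ℝ u (x + t • a) :=
        (measurePreserving_add_right volume (t • a)).quasiMeasurePreserving.ae hd
      filter_upwards [hd, hd'] with x hx hx'
      have hx'' : DifferentiableAt ℝ (fun y => u (y + t • a)) x :=
        (differentiableAt_comp_add_right (t • a)).2 hx'
      have hx₃ : DifferentiableAt ℝ (fun y => u (y + t • a) - u y) x := hx''.sub hx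
      rw [fderiv_fun_const_smul hx₃, fderiv_fun_sub hx'' hx, fderiv_comp_add_right]
      simp; ring
    have i1 : Integrable fun x => fderiv ℝ u (x + t • a) b * k x :=
      hkI.bdd_mul ((measurable_fderiv_apply u b).comp
        (measurable_id.add_const (t • a))).aestronglyMeasurable
        (Eventually.of_forall fun x => hub (x + t • a))
    have i2 : Integrable fun x => fderiv ℝ u x b * k x :=
      hkI.bdd_mul (measurable_fderiv_apply u b).aestronglyMeasurable
        (Eventually.of_forall fun x => hub x)
    have i3 : Integrable fun x => fderiv ℝ u x b * k (x - t • a) :=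
      (hkI.comp_sub_right (t • a)).bdd_mul (measurable_fderiv_apply u b).aestronglyMeasurable
        (Eventually.of_forall fun x => hub x)
    have e5 : ∫ x, fderiv ℝ u (x + t • a) b * k x = ∫ x, fderiv ℝ u x b * k (x - t • a) := by
      rw [← integral_add_right_eq_self (fun x => fderiv ℝ u x b * k (x - t • a)) (t • a)]
      simp
    have e6 : ∫ x, (t⁻¹ • (k (x + t • (-a)) - k x)) * K.indicator (fun x => fderiv ℝ u x b) x
        = ∫ x, (t⁻¹ * (fderiv ℝ u x b * k (x - t • a)) - t⁻¹ * (fderiv ℝ u x b * k x)) := by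
      refine integral_congr_ae (Eventually.of_forall fun x => ?_)
      by_cases hx : x ∈ K
      · simp only [Set.indicator_of_mem hx, smul_neg, smul_eq_mul, ← sub_eq_add_neg]; ring
      · have z1 : k x = 0 := by
          refine image_eq_zero_of_notMem_tsupport fun h => hx ?_
          exact self_subset_cthickening _ h
        have z2 : k (x - t • a) = 0 := by
          refine image_eq_zero_of_notMem_tsupport fun h => hx ?_
          refine mem_cthickening_of_dist_le x _ _ _ h ?_
          rw [dist_eq_norm, sub_sub_cancel, norm_smul, Real.norm_of_nonneg ht0.le]
          nlinarith [norm_nonneg a]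
        simp [hx, z1, z2]
    rw [e3, e4, e6, integral_sub (i1.const_mul _) (i2.const_mul _),
      integral_sub (i3.const_mul _) (i2.const_mul _), integral_const_mul, integral_const_mul,
      integral_const_mul, e5]
  have h4 := tendsto_nhds_unique (h1.congr' h3) h2.neg
  have e7 : ∫ x, lineDeriv ℝ u x a * fderiv ℝ k x b = ∫ x, fderiv ℝ u x a * fderiv ℝ k x b := by
    refine integral_congr_ae ?_
    filter_upwards [hu.ae_differentiableAt] with x hx
    rw [hx.lineDeriv_eq_fderiv]
  have e8 : -∫ x, lineDeriv ℝ k x (-a) * K.indicator (fun x => fderiv ℝ u x b) x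
      = ∫ x, fderiv ℝ u x b * fderiv ℝ k x a := by
    rw [← integral_neg]
    refine integral_congr_ae ?_
    filter_upwards [hk.ae_differentiableAt] with x hx
    rw [hx.lineDeriv_eq_fderiv]
    by_cases h : x ∈ K
    · simp [h]; ring
    · have : fderiv ℝ k x = 0 := image_eq_zero_of_notMem_tsupport fun h' =>
        h (self_subset_cthickening _ (tsupport_fderiv_subset ℝ h'))
      simp [h, this]
  rw [← e7, h4, e8]

/-- A Lipschitz function on a convex open set whose gradient is a.e. bounded by `M` is
`M`-Lipschitz there. -/
theorem lipschitzOnWith_of_ae_norm_gradient_le {C M : NNReal} {k : E2 → ℝ}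
    (hk : LipschitzWith C k) {U : Set E2} (hU : IsOpen U) (hUc : Convex ℝ U)
    (hb : ∀ᵐ x, x ∈ U → ‖gradient k x‖ ≤ M) : LipschitzOnWith M k U := by
  refine LipschitzOnWith.of_dist_le_mul fun x hx y hy => ?_
  set w := x - y with hw
  have hgood : ∀ᵐ z, DifferentiableAt ℝ k z ∧ (z ∈ U → ‖gradient k z‖ ≤ M) :=
    hk.ae_differentiableAt.and hb
  obtain ⟨G, hG, hGm, hGae⟩ : ∃ G : Set E2, (∀ z ∈ G, DifferentiableAt ℝ k z ∧
      (z ∈ U → ‖gradient k z‖ ≤ M)) ∧ MeasurableSet G ∧ ∀ᵐ z, z ∈ G := by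
    have h := (measurableSet_toMeasurable volume
      {z | ¬ (DifferentiableAt ℝ k z ∧ (z ∈ U → ‖gradient k z‖ ≤ M))}).compl
    refine ⟨_, fun z hz => ?_, h, ?_⟩
    · by_contra hcon
      exact hz (subset_toMeasurable _ _ hcon)
    · rw [ae_iff]
      simp only [mem_compl_iff, not_not, ofPred_mem_eq, measure_toMeasurable]
      exact hgood
  have hline : ∀ᵐ z : E2, ∀ᵐ t : ℝ, z + t • w ∈ G := by
    rw [Measure.ae_ae_comm (p := fun (z : E2) (t : ℝ) => z + t • w ∈ G)]
    · exact Eventually.of_forall fun t =>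
        (measurePreserving_add_right volume (t • w)).quasiMeasurePreserving.ae hGae
    · exact hGm.preimage (by fun_prop)
  have hdense : Dense {z : E2 | ∀ᵐ t : ℝ, z + t • w ∈ G} := Measure.dense_of_ae hline
  have hmain : ∀ z ∈ {z : E2 | ∀ᵐ t : ℝ, z + t • w ∈ G}, z ∈ U → z + w ∈ U →
      |k (z + w) - k z| ≤ M * ‖w‖ := by
    intro z hz hzU hzwU
    have hlip : LipschitzWith (C * ‖w‖₊) fun t : ℝ => k (z + t • w) := by
      refine hk.comp (LipschitzWith.of_dist_le_mul fun s t => ?_)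
      rw [dist_add_left, dist_eq_norm, ← sub_smul, norm_smul, mul_comm]
      rfl
    have hac : AbsolutelyContinuousOnInterval (fun t : ℝ => k (z + t • w)) 0 1 :=
      (hlip.lipschitzOnWith (s := uIcc 0 1)).absolutelyContinuousOnInterval
    have hftc := hac.integral_deriv_eq_sub
    have hbd : ∀ᵐ t : ℝ, t ∈ uIoc (0:ℝ) 1 → ‖deriv (fun t : ℝ => k (z + t • w)) t‖ ≤ M * ‖w‖ := by
      filter_upwards [hz] with t ht htI
      rw [uIoc_of_le zero_le_one] at htI
      obtain ⟨hd, hM⟩ := hG _ ht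
      have hU' : z + t • w ∈ U := by
        have := hUc.add_smul_sub_mem hzU hzwU ⟨htI.1.le, htI.2⟩
        simpa using this
      have hder : HasDerivAt (fun t : ℝ => k (z + t • w)) (fderiv ℝ k (z + t • w) w) t := by
        have h1 : HasDerivAt (fun t : ℝ => z + t • w) w t := by
          simpa using ((hasDerivAt_id t).smul_const w).const_add z
        exact hd.hasFDerivAt.comp_hasDerivAt t h1
      rw [hder.deriv]
      refine (ContinuousLinearMap.le_opNorm _ _).trans ?_
      rw [← norm_gradient_eq]
      gcongr
      exact hM hU'
    have := intervalIntegral.norm_integral_le_of_norm_le_const_ae hbd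
    rw [hftc] at this
    simpa using this
  have hcl : y ∈ closure ({z : E2 | ∀ᵐ t : ℝ, z + t • w ∈ G} ∩ {z | z ∈ U ∧ z + w ∈ U}) := by
    rw [inter_comm]
    have hop : IsOpen {z : E2 | z ∈ U ∧ z + w ∈ U} :=
      hU.inter (hU.preimage (continuous_add_const w))
    exact hdense.open_subset_closure_inter hop ⟨hy, by simpa [hw] using hx⟩
  have hclosed : IsClosed {z : E2 | |k (z + w) - k z| ≤ M * ‖w‖} :=
    isClosed_le (by have := hk.continuous; fun_prop) continuous_const
  have : |k (y + w) - k y| ≤ M * ‖w‖ :=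
    closure_minimal (fun z hz => hmain z hz.1 hz.2.1 hz.2.2) hclosed hcl
  simpa [hw, Real.dist_eq, dist_eq_norm] using this

theorem eq_zero_of_ae_gradient_eq_zero {C : NNReal} {k : E2 → ℝ} (hk : LipschitzWith C k)
    (hkc : HasCompactSupport k) (h0 : ∀ᵐ x, gradient k x = 0) : ∀ x, k x = 0 := by
  have h := lipschitzOnWith_of_ae_norm_gradient_le (M := 0) hk isOpen_univ convex_univ
    (by filter_upwards [h0] with x hx _; simp [hx])
  obtain ⟨y, hy⟩ : ∃ y, y ∉ tsupport k := by
    by_contra! hall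
    exact noncompact_univ E2 ((Set.eq_univ_of_forall hall) ▸ hkc)
  intro x
  have := h.dist_le_mul x (mem_univ _) y (mem_univ _)
  rw [image_eq_zero_of_notMem_tsupport hy] at this
  simpa using this

/-! ### Radial Lagrangians and comparison for minimizers -/

section ConvexDerivative

variable {f : ℝ → ℝ}

theorem dtop_mul_lt_sub (hf : StrictConvexOn ℝ (Ici 0) f) (h1 : ContDiffOn ℝ 1 f (Ici 0))
    {x y : ℝ} (hx : 0 ≤ x) (hxy : x < y) : dtop f x * (y - x) < f y - f x := by
  have h := hf.derivWithin_lt_slope (x := x) (y := y) hx (hx.trans hxy.le) hxy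
    (h1.differentiableOn (by norm_num) x hx)
  rwa [slope_def_field, lt_div_iff₀ (sub_pos.2 hxy)] at h

theorem sub_lt_dtop_mul (hf : StrictConvexOn ℝ (Ici 0) f) (h1 : ContDiffOn ℝ 1 f (Ici 0))
    {x y : ℝ} (hx : 0 ≤ x) (hxy : x < y) : f y - f x < dtop f y * (y - x) := by
  have h := hf.slope_lt_derivWithin (x := x) (y := y) hx (hx.trans hxy.le) hxy
    (h1.differentiableOn (by norm_num) y (hx.trans hxy.le))
  rwa [slope_def_field, div_lt_iff₀ (sub_pos.2 hxy)] at h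

theorem strictMonoOn_dtop (hf : StrictConvexOn ℝ (Ici 0) f) (h1 : ContDiffOn ℝ 1 f (Ici 0)) :
    StrictMonoOn (dtop f) (Ici 0) := fun x hx y _ hxy => by
  have := (dtop_mul_lt_sub hf h1 hx hxy).trans (sub_lt_dtop_mul hf h1 hx hxy)
  exact lt_of_mul_lt_mul_right this (sub_pos.2 hxy).le

theorem add_dtop_mul_le (hf : StrictConvexOn ℝ (Ici 0) f) (h1 : ContDiffOn ℝ 1 f (Ici 0))
    {x y : ℝ} (hx : 0 ≤ x) (hy : 0 ≤ y) : f x + dtop f x * (y - x) ≤ f y := by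
  rcases lt_trichotomy x y with h | h | h
  · linarith [dtop_mul_lt_sub hf h1 hx h]
  · simp [h]
  · linarith [sub_lt_dtop_mul hf h1 hy h]

theorem continuousOn_dtop (h1 : ContDiffOn ℝ 1 f (Ici 0)) : ContinuousOn (dtop f) (Ici 0) :=
  h1.continuousOn_derivWithin (uniqueDiffOn_Ici 0) le_rfl

end ConvexDerivative

/-- A strictly convex `C¹` function on `[0,∞)` with vanishing derivative at the origin, so that
`p ↦ f ‖p‖` is a strictly convex `C¹` function. -/
structure RadialLagrangian (f : ℝ → ℝ) : Prop where
  conv : StrictConvexOn ℝ (Ici 0) f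
  contDiff : ContDiffOn ℝ 1 f (Ici 0)
  dtop_zero : dtop f 0 = 0

namespace RadialLagrangian

variable {f : ℝ → ℝ} {Ω : Set E2} {ψ u : E2 → ℝ}

theorem dtop_nonneg (hf : RadialLagrangian f) {x : ℝ} (hx : 0 ≤ x) : 0 ≤ dtop f x := by
  rw [← hf.dtop_zero]
  exact (strictMonoOn_dtop hf.conv hf.contDiff).monotoneOn self_mem_Ici hx hx

theorem strictMonoOn (hf : RadialLagrangian f) : StrictMonoOn f (Ici 0) := fun x hx y _ hxy => by
  have := dtop_mul_lt_sub hf.conv hf.contDiff hx hxy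
  nlinarith [hf.dtop_nonneg hx, sub_pos.2 hxy]

theorem midpoint_lt (hf : RadialLagrangian f) {p q : E2} (hpq : p ≠ q) :
    f ‖(1 / 2 : ℝ) • (p + q)‖ < (f ‖p‖ + f ‖q‖) / 2 := by
  have hle : ‖(1 / 2 : ℝ) • (p + q)‖ ≤ 1 / 2 * ‖p‖ + 1 / 2 * ‖q‖ := by
    rw [norm_smul, Real.norm_of_nonneg (by norm_num)]
    linarith [norm_add_le p q]
  by_cases hn : ‖p‖ = ‖q‖
  · have hlt : ‖(1 / 2 : ℝ) • (p + q)‖ < ‖q‖ := by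
      have h1 : ‖p + q‖ < ‖p‖ + ‖q‖ := by
        refine lt_of_le_of_ne (norm_add_le p q) fun h => hpq ?_
        exact (sameRay_iff_norm_add.2 h).eq_of_norm_eq hn
      rw [norm_smul, Real.norm_of_nonneg (by norm_num)]
      linarith
    have := hf.strictMonoOn (norm_nonneg _) (norm_nonneg q) hlt
    rw [hn]; linarith
  · have h1 := hf.conv.2 (norm_nonneg p) (norm_nonneg q) hn (show (0:ℝ) < 1 / 2 by norm_num)
      (show (0:ℝ) < 1 / 2 by norm_num) (by norm_num)
    simp only [smul_eq_mul] at h1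
    have h2 := hf.strictMonoOn.monotoneOn (norm_nonneg ((1 / 2 : ℝ) • (p + q)))
      (show (0:ℝ) ≤ 1 / 2 * ‖p‖ + 1 / 2 * ‖q‖ by positivity) hle
    linarith

theorem midpoint_le (hf : RadialLagrangian f) (p q : E2) :
    f ‖(1 / 2 : ℝ) • (p + q)‖ ≤ (f ‖p‖ + f ‖q‖) / 2 := by
  by_cases h : p = q
  · subst h
    rw [← two_smul ℝ, smul_smul]; norm_num
  · exact (hf.midpoint_lt h).le

theorem exists_subgradient (hf : RadialLagrangian f) (p : E2) :
    ∃ ξ : E2, ∀ q : E2, f ‖p‖ + ⟪ξ, q - p⟫ ≤ f ‖q‖ := by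
  refine ⟨(dtop f ‖p‖ / ‖p‖) • p, fun q => ?_⟩
  have h1 := add_dtop_mul_le hf.conv hf.contDiff (norm_nonneg p) (norm_nonneg q)
  by_cases hp : p = 0
  · subst hp
    simp only [norm_zero, hf.dtop_zero] at h1 ⊢
    simpa using h1
  · have hp' : 0 < ‖p‖ := norm_pos_iff.2 hp
    have h2 : ⟪(dtop f ‖p‖ / ‖p‖) • p, q - p⟫ ≤ dtop f ‖p‖ * (‖q‖ - ‖p‖) := by
      rw [real_inner_smul_left, inner_sub_right, real_inner_self_eq_norm_sq]
      have h3 : ⟪p, q⟫ - ‖p‖ ^ 2 ≤ ‖p‖ * (‖q‖ - ‖p‖) := by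
        nlinarith [real_inner_le_norm p q]
      calc dtop f ‖p‖ / ‖p‖ * (⟪p, q⟫ - ‖p‖ ^ 2)
          ≤ dtop f ‖p‖ / ‖p‖ * (‖p‖ * (‖q‖ - ‖p‖)) := by
            gcongr
            exact div_nonneg (hf.dtop_nonneg (norm_nonneg p)) hp'.le
        _ = dtop f ‖p‖ * (‖q‖ - ‖p‖) := by field_simp
    linarith

theorem measurable_comp_norm_gradient (hf : RadialLagrangian f) (w : E2 → ℝ) :
    Measurable fun x => f ‖gradient w x‖ := by
  have hc : Continuous fun t : ℝ => f (max t 0) :=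
    hf.contDiff.continuousOn.comp_continuous (by fun_prop) fun t => le_max_right t 0
  simpa [Function.comp_def] using hc.measurable.comp (measurable_gradient w).norm

theorem integrableOn (hf : RadialLagrangian f) (hΩb : Bornology.IsBounded Ω) {C : NNReal}
    {w : E2 → ℝ} (hw : LipschitzWith C w) : IntegrableOn (fun x => f ‖gradient w x‖) Ω := by
  refine Measure.integrableOn_of_bounded (M := max |f 0| |f C|) hΩb.measure_lt_top.ne
    (hf.measurable_comp_norm_gradient w).aestronglyMeasurable (Eventually.of_forall fun x => ?_)
  have h1 := hf.strictMonoOn.monotoneOn self_mem_Ici (norm_nonneg (gradient w x)) (norm_nonneg _)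
  have h2 := hf.strictMonoOn.monotoneOn (norm_nonneg (gradient w x)) (C.2 : (0:ℝ) ≤ C)
    (hw.norm_gradient_le x)
  exact abs_le_max_abs_abs h1 h2

theorem le_J_add (hΩo : IsOpen Ω) (hs : SolvesP f Ω ψ u) {C D : NNReal}
    (hu : LipschitzWith C u) {k : E2 → ℝ} (hk : LipschitzWith D k) (hk0 : ∀ x ∉ Ω, k x = 0)
    (c : ℝ) : J f Ω u ≤ J f Ω fun x => u x + c * k x := by
  refine hs.2.2 _ ⟨_, (hu.add ((lipschitzWith_smul c).comp hk)).lipschitzOnWith⟩ fun x hx => ?_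
  have : x ∉ Ω := fun h => by
    rw [hΩo.frontier_eq] at hx; exact hx.2 h
  simp [hk0 x this, hs.2.1 hx]

/-- A competitor of the form `u + c k` with `k ≥ 0` and no larger energy is trivial. -/
theorem eq_zero_of_J_le (hf : RadialLagrangian f) (hΩo : IsOpen Ω) (hΩb : Bornology.IsBounded Ω)
    (hs : SolvesP f Ω ψ u) {C D : NNReal}
    (hu : LipschitzWith C u) {k : E2 → ℝ} (hk : LipschitzWith D k) (hk0 : ∀ x ∉ Ω, k x = 0)
    (hkpos : ∀ x, 0 ≤ k x) {c : ℝ} (hc : c ≠ 0)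
    (hJ : J f Ω (fun x => u x + c * k x) ≤ J f Ω u) : ∀ x, k x = 0 := by
  have hcs : HasCompactSupport k :=
    HasCompactSupport.intro hΩb.isCompact_closure fun x hx => hk0 x fun h => hx (subset_closure h)
  have hw : LipschitzWith _ fun x => u x + c * k x := hu.add ((lipschitzWith_smul c).comp hk)
  have hm : LipschitzWith _ fun x => u x + c / 2 * k x :=
    hu.add ((lipschitzWith_smul (c / 2)).comp hk)
  have iu := hf.integrableOn hΩb hu
  have iw := hf.integrableOn hΩb hw
  have im := hf.integrableOn hΩb hm
  have hJm := le_J_add hΩo hs hu hk hk0 (c / 2)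
  have hgr : ∀ᵐ x, ∀ d : ℝ, gradient (fun x => u x + d * k x) x
      = gradient u x + d • gradient k x := by
    filter_upwards [hu.ae_differentiableAt, hk.ae_differentiableAt] with x hx hx' d
    rw [gradient_add_of_differentiableAt hx (hx'.const_mul d),
      gradient_const_mul_of_differentiableAt hx']
  have hmid : ∀ᵐ x, gradient (fun x => u x + c / 2 * k x) x
      = (1 / 2 : ℝ) • (gradient u x + gradient (fun x => u x + c * k x) x) := by
    filter_upwards [hgr] with x hx
    rw [hx, hx]; module
  set G : E2 → ℝ := fun x => (f ‖gradient u x‖ + f ‖gradient (fun x => u x + c * k x) x‖) / 2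
    - f ‖gradient (fun x => u x + c / 2 * k x) x‖ with hG
  have hGnn : 0 ≤ᵐ[volume.restrict Ω] G := by
    refine ae_restrict_of_ae ?_
    filter_upwards [hmid] with x hx
    simp only [hG, Pi.zero_apply, hx]
    linarith [hf.midpoint_le (gradient u x) (gradient (fun x => u x + c * k x) x)]
  have hGi : IntegrableOn G Ω := ((iu.add iw).div_const 2).sub im
  have hGint : ∫ x in Ω, G x = (J f Ω u + J f Ω fun x => u x + c * k x) / 2
      - J f Ω fun x => u x + c / 2 * k x := by
    have i1 : IntegrableOn (fun x => (f ‖gradient u x‖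
      + f ‖gradient (fun x => u x + c * k x) x‖) / 2) Ω := (iu.add iw).div_const 2
    simp only [J, hG]
    rw [integral_sub i1 im, integral_div, integral_add iu iw]
  have hG0 : ∫ x in Ω, G x = 0 := le_antisymm (by rw [hGint]; linarith) (integral_nonneg_of_ae hGnn)
  rw [setIntegral_eq_zero_iff_of_nonneg_ae hGnn hGi] at hG0
  refine eq_zero_of_ae_gradient_eq_zero hk hcs ?_
  rw [EventuallyEq, ae_restrict_iff' hΩo.measurableSet] at hG0
  filter_upwards [hG0, hmid, hgr] with x hx hx' hx''
  by_cases hxΩ : x ∈ Ω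
  · by_contra hne
    have hlt := hf.midpoint_lt (p := gradient u x) (q := gradient (fun x => u x + c * k x) x)
      (by rw [hx'' c]; simpa [hc] using hne)
    have := hx hxΩ
    simp only [hG, Pi.zero_apply, hx'] at this
    linarith
  · exact gradient_eq_zero_of_nonneg hkpos (hk0 x hxΩ)

/-- Minimizers lie below affine functions that dominate their boundary values. -/
theorem le_affine (hf : RadialLagrangian f) (hΩo : IsOpen Ω) (hΩb : Bornology.IsBounded Ω)
    (hs : SolvesP f Ω ψ u) {C : NNReal} (hu : LipschitzWith C u) {b : E2} {d : ℝ}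
    (hb : ∀ x ∈ frontier Ω, ψ x ≤ ⟪b, x⟫ + d) : ∀ x ∈ Ω, u x ≤ ⟪b, x⟫ + d := by
  have hL : LipschitzWith ‖innerSL ℝ b‖₊ fun x : E2 => ⟪b, x⟫ + d := by
    have := (innerSL ℝ b).lipschitz.add (LipschitzWith.const d)
    rwa [add_zero] at this
  set H : E2 → ℝ := fun x => max (u x - (⟪b, x⟫ + d)) 0 with hH
  have hHl : LipschitzWith _ H := (hu.sub hL).max_const 0
  set k := Ω.indicator H with hk
  have hkl : LipschitzWith _ k := hHl.indicator_of_frontier fun x hx => by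
    have := hb x hx
    rw [← hs.2.1 hx] at this
    simp only [hH]; exact max_eq_right (by linarith)
  have hk0 : ∀ x ∉ Ω, k x = 0 := fun x hx => indicator_of_notMem hx _
  have hkpos : ∀ x, 0 ≤ k x := fun x => indicator_nonneg (fun _ _ => le_max_right _ _) x
  have hcs : HasCompactSupport k :=
    HasCompactSupport.intro hΩb.isCompact_closure fun x hx => hk0 x fun h => hx (subset_closure h)
  obtain ⟨ξ, hξ⟩ := hf.exists_subgradient b
  have hw : LipschitzWith _ fun x => u x + (-1) * k x :=
    hu.add ((lipschitzWith_smul (-1 : ℝ)).comp hkl)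
  have iu := hf.integrableOn hΩb hu
  have iw := hf.integrableOn hΩb hw
  have ik : Integrable fun x => fderiv ℝ k x ξ := integrable_fderiv hkl hcs ξ
  have hpt : ∀ᵐ x, x ∈ Ω → f ‖gradient (fun x => u x + (-1) * k x) x‖
      ≤ f ‖gradient u x‖ - fderiv ℝ k x ξ := by
    filter_upwards [hu.ae_differentiableAt, hkl.ae_differentiableAt] with x hx hx' hxΩ
    rw [gradient_add_of_differentiableAt hx (hx'.const_mul (-1)),
      gradient_const_mul_of_differentiableAt hx', ← inner_gradient_left, real_inner_comm]
    rcases (hkpos x).eq_or_lt with h0 | h0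
    · simp [gradient_eq_zero_of_nonneg hkpos h0.symm]
    · have hev : k =ᶠ[𝓝 x] fun y => u y - (⟪b, y⟫ + d) := by
        filter_upwards [hΩo.mem_nhds hxΩ,
          hkl.continuous.continuousAt.eventually (lt_mem_nhds h0)] with y hy hy'
        rw [hk, indicator_of_mem hy, hH] at hy' ⊢
        simp only [lt_max_iff, lt_irrefl, or_false] at hy'
        exact max_eq_left hy'.le
      have hgk : gradient k x = gradient u x - b := by
        rw [hev.gradient_eq, gradient_sub_of_differentiableAt hx
          ((differentiableAt_inner_const_left b x).add_const d), gradient_add_const,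
          gradient_inner_const_left]
      have := hξ (gradient u x)
      rw [hgk]
      have e : gradient u x + (-1 : ℝ) • (gradient u x - b) = b := by module
      rw [e]; linarith
  have hJ : J f Ω (fun x => u x + (-1) * k x) ≤ J f Ω u := by
    have h1 : ∫ x in Ω, fderiv ℝ k x ξ = 0 := by
      rw [setIntegral_eq_integral_of_forall_compl_eq_zero, integral_fderiv_eq_zero hkl hcs]
      intro x hx
      rw [← inner_gradient_left, gradient_eq_zero_of_nonneg hkpos (hk0 x hx), inner_zero_left]
    calc J f Ω (fun x => u x + (-1) * k x)
        ≤ ∫ x in Ω, (f ‖gradient u x‖ - fderiv ℝ k x ξ) :=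
          setIntegral_mono_on_ae iw (iu.sub ik.integrableOn) hΩo.measurableSet hpt
      _ = J f Ω u := by rw [integral_sub iu ik.integrableOn, h1, sub_zero, J]
  intro x hx
  have := hf.eq_zero_of_J_le hΩo hΩb hs hu hkl hk0 hkpos (by norm_num) hJ x
  rw [hk, indicator_of_mem hx] at this
  have := max_eq_right_iff.1 this
  linarith

end RadialLagrangian

theorem SolvesP.neg {f : ℝ → ℝ} {Ω : Set E2} {ψ u : E2 → ℝ} (hs : SolvesP f Ω ψ u) :
    SolvesP f Ω (fun x => -ψ x) (fun x => -u x) := by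
  have hJ : ∀ w : E2 → ℝ, J f Ω (fun x => -w x) = J f Ω w := fun w => by
    simp [J, gradient_neg_apply]
  refine ⟨?_, fun x hx => by simp [hs.2.1 hx], fun w hw hwψ => ?_⟩
  · obtain ⟨L, hL⟩ := hs.1
    exact ⟨L, hL.neg⟩
  · rw [hJ, ← hJ w]
    obtain ⟨L, hL⟩ := hw
    exact hs.2.2 _ ⟨L, hL.neg⟩ fun x hx => by simp [hwψ hx]

theorem RadialLagrangian.affine_le {f : ℝ → ℝ} {Ω : Set E2} {ψ u : E2 → ℝ}
    (hf : RadialLagrangian f) (hΩo : IsOpen Ω) (hΩb : Bornology.IsBounded Ω)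
    (hs : SolvesP f Ω ψ u) {C : NNReal} (hu : LipschitzWith C u) {b : E2} {d : ℝ}
    (hb : ∀ x ∈ frontier Ω, ⟪b, x⟫ + d ≤ ψ x) : ∀ x ∈ Ω, ⟪b, x⟫ + d ≤ u x := by
  intro x hx
  have := hf.le_affine hΩo hΩb hs.neg hu.neg (b := -b) (d := -d)
    (fun y hy => by simp only [inner_neg_left]; linarith [hb y hy]) x hx
  simp only [inner_neg_left] at this
  linarith

theorem RadialLagrangian.abs_sub_le_of_mem_frontier {f : ℝ → ℝ} {Ω : Set E2} {ψ u : E2 → ℝ}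
    (hf : RadialLagrangian f) (hΩo : IsOpen Ω) (hΩb : Bornology.IsBounded Ω)
    (hs : SolvesP f Ω ψ u) {C : NNReal} (hu : LipschitzWith C u) {Q : ℝ} (hbsc : BSC Ω ψ Q)
    {x y : E2} (hx : x ∈ frontier Ω) (hy : y ∈ closure Ω) : |u y - u x| ≤ Q * ‖y - x‖ := by
  obtain ⟨a, b, c, d, ha, hb, hab, hac, hbd⟩ := hbsc x hx
  have hux := hs.2.1 hx
  have hbar : ⟪a, y⟫ + c ≤ u y ∧ u y ≤ ⟪b, y⟫ + d := by
    by_cases hyΩ : y ∈ Ω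
    · exact ⟨hf.affine_le hΩo hΩb hs hu (fun z hz => (hab z hz).1) y hyΩ,
        hf.le_affine hΩo hΩb hs hu (fun z hz => (hab z hz).2) y hyΩ⟩
    · have hyf : y ∈ frontier Ω := by rw [hΩo.frontier_eq]; exact ⟨hy, hyΩ⟩
      rw [hs.2.1 hyf]
      exact hab y hyf
  have h1 : ⟪a, y - x⟫ ≥ -(Q * ‖y - x‖) := by
    have := (abs_le.1 (abs_real_inner_le_norm a (y - x))).1
    nlinarith [norm_nonneg (y - x)]
  have h2 : ⟪b, y - x⟫ ≤ Q * ‖y - x‖ := by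
    have := (abs_le.1 (abs_real_inner_le_norm b (y - x))).2
    nlinarith [norm_nonneg (y - x)]
  rw [inner_sub_right] at h1 h2
  rw [abs_le]
  constructor <;> linarith [hbar.1, hbar.2]

/-- Under the bounded slope condition with constant `Q`, minimizers are `Q`-Lipschitz. -/
theorem RadialLagrangian.sub_le_of_bsc {f : ℝ → ℝ} {Ω : Set E2} {ψ u : E2 → ℝ}
    (hf : RadialLagrangian f) (hΩo : IsOpen Ω) (hΩb : Bornology.IsBounded Ω)
    (hs : SolvesP f Ω ψ u) {C : NNReal} (hu : LipschitzWith C u) {Q : ℝ} (hbsc : BSC Ω ψ Q)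
    {x y : E2} (hx : x ∈ Ω) (hy : y ∈ Ω) : u y - u x ≤ Q * ‖y - x‖ := by
  set τ := y - x with hτ
  set D : Set E2 := Ω ∩ {z | z + τ ∈ Ω} with hD
  have hDo : IsOpen D := hΩo.inter (hΩo.preimage (continuous_add_const τ))
  have huτ : LipschitzWith C (fun z => u (z + τ)) := by
    have := hu.comp (isometry_add_right τ).lipschitz
    rwa [mul_one] at this
  set H : E2 → ℝ := fun z => max (u (z + τ) - u z - Q * ‖τ‖) 0 with hH
  have hHl : LipschitzWith _ H :=
    ((huτ.sub hu).sub (LipschitzWith.const (Q * ‖τ‖))).max_const 0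
  set k := D.indicator H with hk
  have hkl : LipschitzWith _ k := hHl.indicator_of_frontier fun z hz => by
    rw [hDo.frontier_eq] at hz
    have hz1 : z ∈ closure Ω := closure_mono inter_subset_left hz.1
    have hz2 : z + τ ∈ closure Ω :=
      map_mem_closure (f := fun w => w + τ) (continuous_add_const τ) hz.1 fun w hw => hw.2
    refine max_eq_right ?_
    by_cases h : z ∈ Ω
    · have h' : z + τ ∈ frontier Ω := by
        rw [hΩo.frontier_eq]; exact ⟨hz2, fun h' => hz.2 ⟨h, h'⟩⟩
      have := (abs_le.1 (hf.abs_sub_le_of_mem_frontier hΩo hΩb hs hu hbsc h' hz1)).1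
      rw [sub_add_cancel_left, norm_neg] at this
      linarith
    · have h' : z ∈ frontier Ω := by rw [hΩo.frontier_eq]; exact ⟨hz1, h⟩
      have := (abs_le.1 (hf.abs_sub_le_of_mem_frontier hΩo hΩb hs hu hbsc h' hz2)).2
      rw [add_sub_cancel_left] at this
      linarith
  have hkD : ∀ z ∉ D, k z = 0 := fun z hz => indicator_of_notMem hz _
  have hk0 : ∀ z ∉ Ω, k z = 0 := fun z hz => hkD z fun h => hz h.1
  have hkpos : ∀ z, 0 ≤ k z := fun z => indicator_nonneg (fun _ _ => le_max_right _ _) z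
  have hkev : ∀ z, 0 < k z → k =ᶠ[𝓝 z] fun w => u (w + τ) - u w - Q * ‖τ‖ := fun z hz => by
    have hzD : z ∈ D := by
      by_contra h
      exact hz.ne' (hkD z h)
    filter_upwards [hDo.mem_nhds hzD,
      hkl.continuous.continuousAt.eventually (lt_mem_nhds hz)] with w hw hw'
    rw [hk, indicator_of_mem hw, hH] at hw' ⊢
    simp only [lt_max_iff, lt_irrefl, or_false] at hw'
    exact max_eq_left hw'.le
  -- the translated perturbation
  have hkτl : LipschitzWith _ (fun z => k (z + -τ)) := hkl.comp (isometry_add_right (-τ)).lipschitz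
  have hkτ0 : ∀ z ∉ Ω, k (z + -τ) = 0 := fun z hz => hkD _ fun h => hz (by
    have := h.2; simpa using this)
  have hduτ : ∀ᵐ z, DifferentiableAt ℝ u (z + τ) :=
    (measurePreserving_add_right volume τ).quasiMeasurePreserving.ae hu.ae_differentiableAt
  set T : E2 → ℝ := fun z =>
    if 0 < k z then f ‖gradient u (z + τ)‖ - f ‖gradient u z‖ else 0 with hT
  have hgk : ∀ z, 0 < k z → DifferentiableAt ℝ u z → DifferentiableAt ℝ u (z + τ) →
      gradient k z = gradient u (z + τ) - gradient u z := fun z hz h1 h2 => by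
    rw [(hkev z hz).gradient_eq, gradient_sub_const, gradient_sub_of_differentiableAt
      ((differentiableAt_comp_add_right τ).2 h2) h1, gradient_comp_add_right]
  have hpt1 : ∀ᵐ z, f ‖gradient (fun z => u z + 1 * k z) z‖ = f ‖gradient u z‖ + T z := by
    filter_upwards [hu.ae_differentiableAt, hkl.ae_differentiableAt, hduτ] with z h1 h2 h3
    rw [gradient_add_of_differentiableAt h1 (h2.const_mul 1),
      gradient_const_mul_of_differentiableAt h2]
    rcases (hkpos z).eq_or_lt with h0 | h0
    · simp [gradient_eq_zero_of_nonneg hkpos h0.symm, hT, ← h0]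
    · simp [hgk z h0 h1 h3, hT, h0]
  have hpt2 : ∀ᵐ z, f ‖gradient (fun z => u z + (-1) * k (z + -τ)) z‖
      = f ‖gradient u z‖ - T (z + -τ) := by
    have q1 := (measurePreserving_add_right (volume : Measure E2)
      (-τ)).quasiMeasurePreserving.ae (hu.ae_differentiableAt (μ := volume))
    filter_upwards [hu.ae_differentiableAt, hkτl.ae_differentiableAt, q1] with z h1 h2 h3
    rw [gradient_add_of_differentiableAt h1 (h2.const_mul (-1)),
      gradient_const_mul_of_differentiableAt h2, gradient_comp_add_right]
    rcases (hkpos (z + -τ)).eq_or_lt with h0 | h0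
    · simp [gradient_eq_zero_of_nonneg hkpos h0.symm, hT, ← h0]
    · simp [hgk _ h0 h3 (by simpa using h1), hT, h0]
  have iu := hf.integrableOn hΩb hu
  have iw := hf.integrableOn hΩb (hu.add ((lipschitzWith_smul (1 : ℝ)).comp hkl))
  have hT0 : ∀ z ∉ Ω, T z = 0 := fun z hz => by simp [hT, hk0 z hz]
  have hTτ0 : ∀ z ∉ Ω, T (z + -τ) = 0 := fun z hz => by simp [hT, hkτ0 z hz]
  have iT : Integrable T := by
    rw [← integrableOn_iff_integrable_of_support_subset (s := Ω)
      (fun z hz => by by_contra h; exact hz (hT0 z h))]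
    refine (iw.sub iu).congr (ae_restrict_of_ae ?_)
    filter_upwards [hpt1] with z hz
    simp only [Pi.sub_apply]
    exact (sub_eq_iff_eq_add').2 hz
  have iTτ : Integrable fun z => T (z + -τ) := iT.comp_add_right (-τ)
  have hJ1 : J f Ω (fun z => u z + 1 * k z) = J f Ω u + ∫ z, T z := by
    rw [← setIntegral_eq_integral_of_forall_compl_eq_zero hT0, J, J,
      ← integral_add iu iT.integrableOn]
    exact integral_congr_ae (ae_restrict_of_ae hpt1)
  have hJ2 : J f Ω (fun z => u z + (-1) * k (z + -τ)) = J f Ω u - ∫ z, T z := by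
    rw [← integral_add_right_eq_self T (-τ),
      ← setIntegral_eq_integral_of_forall_compl_eq_zero hTτ0, J, J,
      ← integral_sub iu iTτ.integrableOn]
    exact integral_congr_ae (ae_restrict_of_ae hpt2)
  have hmin := le_J_add hΩo hs hu hkτl hkτ0 (-1)
  have hzero := hf.eq_zero_of_J_le hΩo hΩb hs hu hkl hk0 hkpos one_ne_zero
    (by rw [hJ1]; rw [hJ2] at hmin; linarith) x
  have hxD : x ∈ D := ⟨hx, by simpa [hτ] using hy⟩
  rw [hk, indicator_of_mem hxD] at hzero
  have := max_eq_right_iff.1 hzero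
  rw [show x + τ = y by simp [hτ]] at this
  linarith

theorem LipschitzOnWith.norm_gradient_le {K : NNReal} {w : E2 → ℝ} {Ω : Set E2}
    (hw : LipschitzOnWith K w Ω) (hΩo : IsOpen Ω) {z : E2} (hz : z ∈ Ω) : ‖gradient w z‖ ≤ K := by
  rw [norm_gradient_eq]
  exact norm_fderiv_le_of_lipschitzOn ℝ (hΩo.mem_nhds hz) hw

theorem Set.EqOn.gradient_eq {u w : E2 → ℝ} {Ω : Set E2} (h : EqOn u w Ω) (hΩo : IsOpen Ω)
    {z : E2} (hz : z ∈ Ω) : gradient u z = gradient w z :=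
  (h.eventuallyEq_of_mem (hΩo.mem_nhds hz)).gradient_eq

theorem convex_of_supporting_frontier {Ω : Set E2} (hΩo : IsOpen Ω)
    (hΩb : Bornology.IsBounded Ω)
    (h : ∀ x₀ ∈ frontier Ω, ∃ n : E2, n ≠ 0 ∧ ∀ x ∈ frontier Ω, 0 ≤ ⟪n, x - x₀⟫) :
    Convex ℝ Ω := by
  have hpos : ∀ x₀ : E2, ∀ n : E2, n ≠ 0 → (∀ x ∈ frontier Ω, 0 ≤ ⟪n, x - x₀⟫) →
      ∀ x ∈ Ω, 0 < ⟪n, x - x₀⟫ := by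
    intro x₀ n hn hnx x hx
    by_contra! hle
    have hn2 : 0 < ‖n‖ ^ 2 := by positivity
    obtain ⟨R, hR⟩ := hΩb.exists_norm_le
    set ray : Set E2 := (fun t : ℝ => x - t • n) '' Ici 0 with hray
    have hconn : IsPreconnected ray :=
      isPreconnected_Ici.image _ (by fun_prop : Continuous fun t : ℝ => x - t • n).continuousOn
    have hxr : x ∈ ray := ⟨0, self_mem_Ici, by simp⟩
    obtain ⟨w, hwr, hwΩ⟩ : ∃ w ∈ ray, w ∉ Ω := by
      have hR0 : 0 ≤ R := (norm_nonneg x).trans (hR x hx)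
      refine ⟨x - ((2 * R + 1) / ‖n‖) • n, ⟨(2 * R + 1) / ‖n‖, ?_, rfl⟩, fun hm => ?_⟩
      · exact div_nonneg (by linarith) (norm_nonneg n)
      · have h1 := hR _ hm
        have h2 : ‖((2 * R + 1) / ‖n‖) • n‖ = 2 * R + 1 := by
          rw [norm_smul, Real.norm_of_nonneg (div_nonneg (by linarith) (norm_nonneg n)),
            div_mul_cancel₀ _ (norm_ne_zero_iff.2 hn)]
        have h3 := norm_sub_norm_le (((2 * R + 1) / ‖n‖) • n) x
        rw [norm_sub_rev] at h3
        linarith [hR x hx]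
    obtain ⟨y, ⟨t, ht, rfl⟩, hy⟩ := hconn.exists_mem_frontier hxr hx hwr hwΩ
    have ht0 : t ≠ 0 := by
      rintro rfl
      rw [hΩo.frontier_eq] at hy
      exact hy.2 (by simpa using hx)
    have h4 := hnx _ hy
    have h5 : ⟪n, x - t • n - x₀⟫ = ⟪n, x - x₀⟫ - t * ‖n‖ ^ 2 := by
      rw [sub_right_comm, inner_sub_right _ (x - x₀), inner_smul_right, real_inner_self_eq_norm_sq]
    rw [h5] at h4
    have : 0 < t * ‖n‖ ^ 2 := mul_pos (lt_of_le_of_ne ht ht0.symm) hn2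
    linarith
  rw [convex_iff_segment_subset]
  intro x hx y hy z hz
  by_contra hzΩ
  obtain ⟨x₀, hs, hx₀⟩ := (convex_segment (𝕜 := ℝ) x y).isPreconnected.exists_mem_frontier
    (left_mem_segment ℝ x y) hx hz hzΩ
  obtain ⟨n, hn, hnx⟩ := h x₀ hx₀
  have h1 := hpos x₀ n hn hnx x hx
  have h2 := hpos x₀ n hn hnx y hy
  obtain ⟨a, b, ha, hb, hab, rfl⟩ := hs
  have h3 : a * ⟪n, x - (a • x + b • y)⟫ + b * ⟪n, y - (a • x + b • y)⟫ = 0 := by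
    simp only [inner_sub_right, inner_add_right, inner_smul_right]
    linear_combination (-(a * ⟪n, x⟫) - b * ⟪n, y⟫) * hab
  rcases ha.eq_or_lt with h | h
  · have : b = 1 := by linarith
    subst h this
    linarith
  · nlinarith [mul_pos h h1, mul_nonneg hb h2.le]

theorem IsPreconnected.sub_eq_sub_of_ae_gradient_eq {Ω : Set E2} (hc : IsPreconnected Ω)
    (hΩo : IsOpen Ω) {C : NNReal} {v : E2 → ℝ} (hv : LipschitzWith C v) {q : E2}
    (hq : ∀ᵐ z, z ∈ Ω → gradient v z = q) {x y : E2} (hx : x ∈ Ω) (hy : y ∈ Ω) :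
    v x - v y = ⟪q, x - y⟫ := by
  have hk := hv.sub (innerSL ℝ q).lipschitz
  have hloc : ∀ z ∈ Ω, HasFDerivAt (fun z => v z - innerSL ℝ q z) (0 : E2 →L[ℝ] ℝ) z := by
    intro z hz
    obtain ⟨r, hr, hrΩ⟩ := Metric.isOpen_iff.1 hΩo z hz
    have := lipschitzOnWith_of_ae_norm_gradient_le (M := 0) hk isOpen_ball (convex_ball z r) (by
      filter_upwards [hq, hv.ae_differentiableAt] with w h1 h2 hw
      have : gradient (fun z => v z - innerSL ℝ q z) w = gradient v w - q := by
        rw [gradient_sub_of_differentiableAt h2 (innerSL ℝ q).differentiableAt]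
        congr 1
        exact gradient_inner_const_left q w
      rw [this, h1 (hrΩ hw)]
      simp)
    refine (hasFDerivAt_const (v z - innerSL ℝ q z) z).congr_of_eventuallyEq ?_
    filter_upwards [ball_mem_nhds z hr] with w hw
    have h1 := this.dist_le_mul w hw z (mem_ball_self hr)
    rw [NNReal.coe_zero, zero_mul] at h1
    exact dist_le_zero.1 h1
  have h := hΩo.is_const_of_fderiv_eq_zero hc
    (fun z hz => (hloc z hz).differentiableAt.differentiableWithinAt)
    (fun z hz => (hloc z hz).fderiv) hx hy
  simp only [innerSL_apply_apply] at h
  rw [inner_sub_right]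
  linarith

/-- The rotated flux `(−f'(|p|)p₁/|p|, f'(|p|)p₀/|p|)`, the gradient of the stream function. -/
def rotFlux (h : ℝ → ℝ) (p : E2) : E2 := (h ‖p‖ / ‖p‖) • !₂[-p 1, p 0]

theorem norm_rot (p : E2) : ‖(!₂[-p 1, p 0] : E2)‖ = ‖p‖ := by
  rw [EuclideanSpace.norm_eq, EuclideanSpace.norm_eq]
  simp [Fin.sum_univ_two, add_comm]

theorem norm_rotFlux {h : ℝ → ℝ} (h0 : h 0 = 0) (p : E2) (hp : 0 ≤ h ‖p‖) :
    ‖rotFlux h p‖ = h ‖p‖ := by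
  rw [rotFlux, norm_smul, norm_rot, Real.norm_of_nonneg (by positivity)]
  by_cases hz : ‖p‖ = 0
  · simp [hz, h0]
  · field_simp

theorem IsStreamFn.ae_gradient_eq {f' : ℝ → ℝ} {Ω : Set E2} {u v : E2 → ℝ}
    (hΩo : IsOpen Ω) (h : IsStreamFn f' Ω u v) :
    ∀ᵐ z, z ∈ Ω → gradient v z = rotFlux f' (gradient u z) := by
  rw [← ae_restrict_iff' hΩo.measurableSet]
  filter_upwards [h.2.2] with z hz
  by_cases h0 : gradient u z = 0
  · ext i
    fin_cases i
    · simpa [rotFlux, h0] using hz.1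
    · simpa [rotFlux, h0] using hz.2
  · simp only [h0, if_false] at hz
    ext i
    fin_cases i
    · simp only [rotFlux, Fin.zero_eta, PiLp.smul_apply, smul_eq_mul]
      rw [hz.1]
      simp
      ring
    · simp only [rotFlux, Fin.mk_one, PiLp.smul_apply, smul_eq_mul]
      rw [hz.2]
      simp
      ring

theorem SolvesP.congr {f : ℝ → ℝ} {Ω : Set E2} {ψ u w : E2 → ℝ} (hs : SolvesP f Ω ψ u)
    (hΩo : IsOpen Ω) (h : EqOn u w (closure Ω)) : SolvesP f Ω ψ w := by
  obtain ⟨L, hL⟩ := hs.1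
  refine ⟨⟨L, fun x hx y hy => by rw [← h hx, ← h hy]; exact hL hx hy⟩, fun x hx => ?_, fun k hk hkψ => ?_⟩
  · rw [← h (frontier_subset_closure hx)]; exact hs.2.1 hx
  · have : J f Ω w = J f Ω u := setIntegral_congr_fun hΩo.measurableSet fun z hz => by
      simp only [(h.mono subset_closure).gradient_eq hΩo hz]
    rw [this]
    exact hs.2.2 k hk hkψ

/-- The gradient of a minimizer is bounded by the bounded slope constant. -/
theorem RadialLagrangian.norm_gradient_le_of_bsc {f : ℝ → ℝ} {Ω : Set E2} {ψ u : E2 → ℝ}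
    (hf : RadialLagrangian f) (hΩo : IsOpen Ω) (hΩb : Bornology.IsBounded Ω)
    (hs : SolvesP f Ω ψ u) {C : NNReal} (hu : LipschitzWith C u) {Q : ℝ} (hQ : 0 ≤ Q)
    (hbsc : BSC Ω ψ Q) {z : E2} (hz : z ∈ Ω) : ‖gradient u z‖ ≤ Q := by
  lift Q to NNReal using hQ
  refine LipschitzOnWith.norm_gradient_le (Ω := Ω)
    (LipschitzOnWith.of_dist_le_mul fun x hx y hy => ?_) hΩo hz
  rw [Real.dist_eq, abs_le, dist_eq_norm]
  have h1 := hf.sub_le_of_bsc hΩo hΩb hs hu hbsc hx hy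
  have h2 := hf.sub_le_of_bsc hΩo hΩb hs hu hbsc hy hx
  rw [norm_sub_rev] at h1
  constructor <;> linarith

/-- Under the bounded slope condition, stream functions of minimizers are Lipschitz with a
constant depending only on `f'` at the bounded slope constant. -/
theorem IsStreamFn.abs_sub_le_of_bsc {f : ℝ → ℝ} {Ω : Set E2} {ψ u v : E2 → ℝ}
    (hv : IsStreamFn (dtop f) Ω u v)
    (hf : RadialLagrangian f) (hΩo : IsOpen Ω) (hΩb : Bornology.IsBounded Ω)
    (hc : IsPreconnected Ω) (hs : SolvesP f Ω ψ u) {Q : ℝ} (hQ : 0 ≤ Q)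
    (hbsc : BSC Ω ψ Q) {x y : E2} (hx : x ∈ Ω) (hy : y ∈ Ω) :
    |v x - v y| ≤ dtop f Q * ‖x - y‖ := by
  have hgv := hv.ae_gradient_eq hΩo
  obtain ⟨L, hL⟩ := hs.1
  obtain ⟨w, hw, huw⟩ := hL.extend_real
  obtain ⟨L', hL'⟩ := hv.1
  obtain ⟨k, hk, hvk⟩ := hL'.extend_real
  replace hs := hs.congr hΩo huw
  rw [hvk hx, hvk hy]
  have hgk : ∀ᵐ z, z ∈ Ω → gradient k z = rotFlux (dtop f) (gradient w z) := by
    filter_upwards [hgv] with z h hz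
    rw [← hvk.gradient_eq hΩo hz, h hz, (huw.mono subset_closure).gradient_eq hΩo hz]
  have hmono := (strictMonoOn_dtop hf.conv hf.contDiff).monotoneOn
  have hnf : ∀ p : E2, ‖p‖ ≤ Q → ‖rotFlux (dtop f) p‖ ≤ dtop f Q := fun p hp => by
    rw [norm_rotFlux hf.dtop_zero _ (hf.dtop_nonneg (norm_nonneg _))]
    exact hmono (norm_nonneg p) hQ hp
  by_cases haff : ∃ a : E2, ∃ c : ℝ, ‖a‖ ≤ Q ∧ ∀ x ∈ frontier Ω, ψ x = ⟪a, x⟫ + c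
  · obtain ⟨a, c, ha, hac⟩ := haff
    have hwa : EqOn w (fun z => ⟪a, z⟫ + c) Ω := fun z hz => le_antisymm
      (hf.le_affine hΩo hΩb hs hw (fun z hz => (hac z hz).le) z hz)
      (hf.affine_le hΩo hΩb hs hw (fun z hz => (hac z hz).ge) z hz)
    rw [hc.sub_eq_sub_of_ae_gradient_eq hΩo hk (q := rotFlux (dtop f) a) (by
      filter_upwards [hgk] with z h hz
      rw [h hz, hwa.gradient_eq hΩo hz, gradient_add_const, gradient_inner_const_left]) hx hy]
    exact (abs_real_inner_le_norm _ _).trans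
      (mul_le_mul_of_nonneg_right (hnf a ha) (norm_nonneg _))
  · have hconv : Convex ℝ Ω := by
      refine convex_of_supporting_frontier hΩo hΩb fun x₀ hx₀ => ?_
      obtain ⟨a, b, c, d, ha, hb, hab, hac, hbd⟩ := hbsc x₀ hx₀
      refine ⟨b - a, fun h => haff ⟨a, c, ha, fun x hx => ?_⟩, fun x hx => ?_⟩
      · rw [sub_eq_zero] at h
        subst h
        have := hab x hx
        linarith
      · have := hab x hx
        rw [inner_sub_right, inner_sub_left, inner_sub_left]
        linarith
    have h := lipschitzOnWith_of_ae_norm_gradient_le (M := ⟨dtop f Q, hf.dtop_nonneg hQ⟩)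
      hk hΩo hconv (by
        filter_upwards [hgk] with z h hz
        rw [h hz]
        exact hnf _ (hf.norm_gradient_le_of_bsc hΩo hΩb hs hw hQ hbsc hz))
    have := h.dist_le_mul x hx y hy
    rwa [Real.dist_eq, dist_eq_norm] at this

/-- The inverse on `[0,∞)` of the regularized flux `ρ ↦ h ρ + ε ρ`. -/
def regInv (h : ℝ → ℝ) (ε : ℝ) : ℝ → ℝ := Function.invFunOn (fun ρ => h ρ + ε * ρ) (Ici 0)

/-- `h` is an admissible radial flux `f'` with vanishing value at the origin, and `G` is its
inverse on `[0,∞)`. -/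
structure IsRadialFlux (h G : ℝ → ℝ) : Prop where
  zero : h 0 = 0
  continuousOn : ContinuousOn h (Ici 0)
  contDiffOn : ContDiffOn ℝ 1 h (Ioi 0)
  strictMonoOn : StrictMonoOn h (Ici 0)
  bijOn : BijOn h (Ici 0) (Ici 0)
  invOn : InvOn G h (Ici 0) (Ici 0)

namespace IsRadialFlux

variable {h G : ℝ → ℝ}

theorem inv_apply (hh : IsRadialFlux h G) {x : ℝ} (hx : 0 ≤ x) : G (h x) = x := hh.invOn.1 hx

theorem apply_inv (hh : IsRadialFlux h G) {r : ℝ} (hr : 0 ≤ r) : h (G r) = r := hh.invOn.2 hr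

theorem inv_nonneg (hh : IsRadialFlux h G) {r : ℝ} (hr : 0 ≤ r) : 0 ≤ G r := by
  obtain ⟨x, hx, rfl⟩ := hh.bijOn.surjOn hr
  rwa [hh.inv_apply hx]

theorem inv_zero (hh : IsRadialFlux h G) : G 0 = 0 := by
  have := hh.inv_apply le_rfl
  rwa [hh.zero] at this

theorem lt_inv_iff (hh : IsRadialFlux h G) {x r : ℝ} (hx : 0 ≤ x) (hr : 0 ≤ r) :
    x < G r ↔ h x < r := by
  rw [← hh.strictMonoOn.lt_iff_lt hx (hh.inv_nonneg hr), hh.apply_inv hr]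

theorem inv_lt_iff (hh : IsRadialFlux h G) {x r : ℝ} (hx : 0 ≤ x) (hr : 0 ≤ r) :
    G r < x ↔ r < h x := by
  rw [← hh.strictMonoOn.lt_iff_lt (hh.inv_nonneg hr) hx, hh.apply_inv hr]

theorem inv_strictMonoOn (hh : IsRadialFlux h G) : StrictMonoOn G (Ici 0) := fun r hr s hs hrs => by
  rwa [hh.lt_inv_iff (hh.inv_nonneg hr) hs, hh.apply_inv hr]

theorem inv_pos (hh : IsRadialFlux h G) {r : ℝ} (hr : 0 < r) : 0 < G r := by
  rwa [hh.lt_inv_iff le_rfl hr.le, hh.zero]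

theorem measurable_inv_comp (hh : IsRadialFlux h G) {X : Type*} [MeasurableSpace X] {k : X → ℝ}
    (hk : Measurable k) (h0 : ∀ x, 0 ≤ k x) : Measurable fun x => G (k x) := by
  have hm : Monotone fun t : ℝ => G (max t 0) := fun s t hst =>
    hh.inv_strictMonoOn.monotoneOn (le_max_right s 0) (le_max_right t 0) (max_le_max_right 0 hst)
  simpa [Function.comp_def, h0] using hm.measurable.comp hk

/-- The regularization `ρ ↦ h ρ + ε ρ` of a radial flux is again a radial flux. -/
theorem add_mul (hh : IsRadialFlux h G) {ε : ℝ} (hε : 0 ≤ ε) :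
    IsRadialFlux (fun ρ => h ρ + ε * ρ) (regInv h ε) := by
  have hc : ContinuousOn (fun ρ => h ρ + ε * ρ) (Ici 0) :=
    hh.continuousOn.add (by fun_prop)
  have hm : StrictMonoOn (fun ρ => h ρ + ε * ρ) (Ici 0) := fun x hx y hy hxy => by
    have := hh.strictMonoOn hx hy hxy
    simp only
    nlinarith
  have hb : BijOn (fun ρ => h ρ + ε * ρ) (Ici 0) (Ici 0) := by
    refine ⟨fun x hx => ?_, hm.injOn, fun r hr => ?_⟩
    · have h1 := hh.bijOn.mapsTo hx
      rw [mem_Ici] at *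
      positivity
    · have hr' := hh.inv_nonneg hr
      have := intermediate_value_Icc hr' (hc.mono Icc_subset_Ici_self)
      obtain ⟨x, hx, hxr⟩ := this (⟨by simpa [hh.zero] using hr, by
        simp only [hh.apply_inv hr]
        nlinarith⟩ : r ∈ Icc _ _)
      exact ⟨x, hx.1, hxr⟩
  exact ⟨by simp [hh.zero], hc, hh.contDiffOn.add (by fun_prop), hm, hb, hb.invOn_invFunOn⟩

theorem tendsto_inv_add_mul (hh : IsRadialFlux h G) {ε : ℕ → ℝ} (hε : ∀ n, 0 ≤ ε n)
    (hlim : Tendsto ε atTop (𝓝 0)) {r : ℝ} (hr : 0 ≤ r) :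
    Tendsto (fun n => regInv h (ε n) r) atTop (𝓝 (G r)) := by
  rw [tendsto_order]
  constructor
  · intro x hx
    rcases lt_or_ge x 0 with h0 | h0
    · exact Eventually.of_forall fun n => h0.trans_le ((hh.add_mul (hε n)).inv_nonneg hr)
    · have h1 : Tendsto (fun n => h x + ε n * x) atTop (𝓝 (h x + 0 * x)) :=
        tendsto_const_nhds.add (hlim.mul_const x)
      rw [hh.lt_inv_iff h0 hr] at hx
      filter_upwards [h1.eventually (gt_mem_nhds (by simpa using hx))] with n hn
      exact ((hh.add_mul (hε n)).lt_inv_iff h0 hr).2 hn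
  · intro x hx
    have h0 : 0 ≤ x := (hh.inv_nonneg hr).trans hx.le
    rw [gt_iff_lt, hh.inv_lt_iff h0 hr] at hx
    refine Eventually.of_forall fun n => ((hh.add_mul (hε n)).inv_lt_iff h0 hr).2 ?_
    nlinarith [mul_nonneg (hε n) h0]

theorem inv_add_mul_le (hh : IsRadialFlux h G) {ε : ℝ} (hε : 0 ≤ ε) {r : ℝ} (hr : 0 ≤ r) :
    regInv h ε r ≤ G r := by
  by_contra! hlt
  rw [(hh.add_mul hε).lt_inv_iff (hh.inv_nonneg hr) hr, hh.apply_inv hr] at hlt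
  nlinarith [mul_nonneg hε (hh.inv_nonneg hr)]

theorem deriv_nonneg (hh : IsRadialFlux h G) {x : ℝ} (hx : 0 < x) : 0 ≤ deriv h x := by
  rw [← derivWithin_of_mem_nhds (Ioi_mem_nhds hx)]
  exact (hh.strictMonoOn.monotoneOn.mono Ioi_subset_Ici_self).derivWithin_nonneg

theorem differentiableAt (hh : IsRadialFlux h G) {x : ℝ} (hx : 0 < x) : DifferentiableAt ℝ h x :=
  (hh.contDiffOn.differentiableOn one_ne_zero).differentiableAt (Ioi_mem_nhds hx)

theorem continuousOn_deriv (hh : IsRadialFlux h G) : ContinuousOn (deriv h) (Ioi 0) :=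
  hh.contDiffOn.continuousOn_deriv_of_isOpen isOpen_Ioi le_rfl

theorem continuousOn_inv (hh : IsRadialFlux h G) : ContinuousOn G (Ioi 0) := fun r hr => by
  refine ContinuousAt.continuousWithinAt ?_
  refine (hh.inv_strictMonoOn.mono Ioi_subset_Ici_self).continuousAt_of_image_mem_nhds
    (Ioi_mem_nhds hr) ?_
  filter_upwards [Ioi_mem_nhds (hh.inv_pos hr)] with x hx
  refine ⟨h x, ?_, hh.inv_apply (le_of_lt hx)⟩
  have := hh.strictMonoOn self_mem_Ici (Ioi_subset_Ici_self hx) hx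
  rwa [hh.zero] at this

theorem hasDerivAt_inv (hh : IsRadialFlux h G) (hd : ∀ x, 0 < x → deriv h x ≠ 0) {r : ℝ}
    (hr : 0 < r) : HasDerivAt G (deriv h (G r))⁻¹ r := by
  refine HasDerivAt.of_local_left_inverse (f := h)
    (hh.continuousOn_inv.continuousAt (Ioi_mem_nhds hr))
    (hh.differentiableAt (hh.inv_pos hr)).hasDerivAt (hd _ (hh.inv_pos hr)) ?_
  filter_upwards [Ioi_mem_nhds hr] with s hs
  exact hh.apply_inv (le_of_lt hs)

theorem contDiffOn_inv (hh : IsRadialFlux h G) (hd : ∀ x, 0 < x → deriv h x ≠ 0) :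
    ContDiffOn ℝ 1 G (Ioi 0) := by
  rw [← zero_add 1, contDiffOn_succ_iff_deriv_of_isOpen isOpen_Ioi]
  refine ⟨fun r hr => (hh.hasDerivAt_inv hd hr).differentiableAt.differentiableWithinAt,
    by simp, ?_⟩
  rw [contDiffOn_zero]
  refine ContinuousOn.congr ?_ fun r hr => (hh.hasDerivAt_inv hd hr).deriv
  exact (hh.continuousOn_deriv.comp hh.continuousOn_inv fun r hr => hh.inv_pos hr).inv₀
    fun r hr => hd _ (hh.inv_pos hr)

theorem inner_sub_pos (hh : IsRadialFlux h G) {p q : E2} (hpq : p ≠ q) :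
    0 < ⟪(G ‖p‖ / ‖p‖) • p - (G ‖q‖ / ‖q‖) • q, p - q⟫ := by
  have key : ∀ p : E2, G ‖p‖ / ‖p‖ * ‖p‖ = G ‖p‖ := fun p => by
    by_cases hp : ‖p‖ = 0
    · simp [hp, hh.inv_zero]
    · field_simp
  have hk0 : ∀ p : E2, 0 ≤ G ‖p‖ / ‖p‖ := fun p =>
    div_nonneg (hh.inv_nonneg (norm_nonneg p)) (norm_nonneg p)
  have hexp : ⟪(G ‖p‖ / ‖p‖) • p - (G ‖q‖ / ‖q‖) • q, p - q⟫
      = (G ‖p‖ - G ‖q‖) * (‖p‖ - ‖q‖)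
        + (G ‖p‖ / ‖p‖ + G ‖q‖ / ‖q‖) * (‖p‖ * ‖q‖ - ⟪p, q⟫) := by
    simp only [inner_sub_left, inner_sub_right, inner_smul_left, real_inner_self_eq_norm_sq,
      real_inner_comm p q, RCLike.conj_to_real]
    linear_combination (‖p‖ - ‖q‖) * key p + (‖q‖ - ‖p‖) * key q
  rw [hexp]
  have hcs : 0 ≤ ‖p‖ * ‖q‖ - ⟪p, q⟫ := sub_nonneg.2 (real_inner_le_norm p q)
  by_cases hn : ‖p‖ = ‖q‖
  · have hlt : ⟪p, q⟫ < ‖p‖ * ‖q‖ := by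
      rw [inner_lt_norm_mul_iff_real, hn]
      intro h
      refine hpq (smul_right_injective E2 (r := ‖q‖) (fun hq0 => ?_) h)
      rw [hq0, norm_eq_zero] at hn
      exact hpq (hn.trans (norm_eq_zero.1 hq0).symm)
    have hp : 0 < ‖p‖ := by
      rw [norm_pos_iff]
      rintro rfl
      simp at hlt
    have := div_pos (hh.inv_pos hp) hp
    rw [hn, sub_self, zero_mul, zero_add, ← hn]
    exact mul_pos (by linarith) (by rw [← hn] at hlt; linarith)
  · have h1 : 0 < (G ‖p‖ - G ‖q‖) * (‖p‖ - ‖q‖) := by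
      rcases lt_or_gt_of_ne hn with h | h
      · have := hh.inv_strictMonoOn (norm_nonneg p) (norm_nonneg q) h
        exact mul_pos_of_neg_of_neg (by linarith) (by linarith)
      · have := hh.inv_strictMonoOn (norm_nonneg q) (norm_nonneg p) h
        exact mul_pos (by linarith) (by linarith)
    have := mul_nonneg (add_nonneg (hk0 p) (hk0 q)) hcs
    linarith

end IsRadialFlux

theorem HasFDerivAt.norm_of_ne_zero {P : E2 → E2} {H : E2 →L[ℝ] E2} {z : E2}
    (hP : HasFDerivAt P H z) (h0 : P z ≠ 0) :
    HasFDerivAt (fun w => ‖P w‖) (‖P z‖⁻¹ • (innerSL ℝ (P z) ∘L H)) z := by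
  have h1 := hP.norm_sq.sqrt (by positivity)
  simp only [Real.sqrt_sq (norm_nonneg _)] at h1
  refine h1.congr_fderiv ?_
  ext e
  have : ‖P z‖ ≠ 0 := norm_ne_zero_iff.2 h0
  simp
  field_simp

theorem fderiv_radial_apply {G : ℝ → ℝ} {G' : ℝ} {P : E2 → E2} {z : E2}
    (hP : DifferentiableAt ℝ P z) (h0 : P z ≠ 0) (hG : HasDerivAt G G' ‖P z‖) (e : E2) :
    fderiv ℝ (fun w => G ‖P w‖ / ‖P w‖ * ⟪P w, e⟫) z e
      = G ‖P z‖ / ‖P z‖ * ⟪e, fderiv ℝ P z e⟫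
        + (G' * ‖P z‖ - G ‖P z‖) / ‖P z‖ ^ 3 * (⟪P z, fderiv ℝ P z e⟫ * ⟪P z, e⟫) := by
  have hr : ‖P z‖ ≠ 0 := norm_ne_zero_iff.2 h0
  have h1 := (hG.div (hasDerivAt_id _) hr).comp_hasFDerivAt z (hP.hasFDerivAt.norm_of_ne_zero h0)
  have h2 := hP.hasFDerivAt.inner ℝ (hasFDerivAt_const e z)
  have h3 := (h1.mul h2).fderiv
  have h4 : (fun w => G ‖P w‖ / ‖P w‖ * ⟪P w, e⟫)
      = (((G / id) ∘ fun w => ‖P w‖) * fun w => ⟪P w, e⟫) := rfl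
  rw [h4, h3]
  simp [real_inner_comm]
  field_simp

theorem sum_inner_mul_inner (H : E2 →L[ℝ] E2) (p : E2) :
    ∑ i : Fin 2, ⟪p, H (EuclideanSpace.basisFun (Fin 2) ℝ i)⟫
      * ⟪p, EuclideanSpace.basisFun (Fin 2) ℝ i⟫ = ⟪H p, p⟫ := by
  have h : p = ∑ i : Fin 2, ⟪p, EuclideanSpace.basisFun (Fin 2) ℝ i⟫
      • EuclideanSpace.basisFun (Fin 2) ℝ i := by
    conv_lhs => rw [← (EuclideanSpace.basisFun (Fin 2) ℝ).sum_repr p]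
    simp [EuclideanSpace.inner_single_right]
  conv_rhs => rw [real_inner_comm]; arg 3; rw [h]
  simp only [map_sum, map_smul, inner_sum, inner_smul_right]
  exact Finset.sum_congr rfl fun i _ => mul_comm _ _

/-- The operator `−(1−t)⟨Hp,p⟩ − t|p|² tr H`. -/
def fenchelOp (t : ℝ) (p : E2) (H : E2 →L[ℝ] E2) : ℝ :=
  -(1 - t) * ⟪H p, p⟫ - ‖p‖ ^ 2 * t * LinearMap.trace ℝ E2 H.toLinearMap

theorem IsRadialFlux.sum_fderiv_radial {h G : ℝ → ℝ} (hh : IsRadialFlux h G)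
    (hd : ∀ x, 0 < x → 0 < deriv h x) {P : E2 → E2} {z : E2}
    (hP : DifferentiableAt ℝ P z) (h0 : P z ≠ 0)
    (hF : 0 ≤ fenchelOp (G ‖P z‖ * deriv h (G ‖P z‖) / h (G ‖P z‖)) (P z) (fderiv ℝ P z)) :
    ∑ i : Fin 2, fderiv ℝ (fun w => G ‖P w‖ / ‖P w‖
      * ⟪P w, EuclideanSpace.basisFun (Fin 2) ℝ i⟫) z (EuclideanSpace.basisFun (Fin 2) ℝ i)
      ≤ 0 := by
  have hr : 0 < ‖P z‖ := norm_pos_iff.2 h0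
  have hρ := hh.inv_pos hr
  have hδ := hd _ hρ
  simp only [fderiv_radial_apply hP h0 (hh.hasDerivAt_inv (fun x hx => (hd x hx).ne') hr)]
  rw [Finset.sum_add_distrib, ← Finset.mul_sum, ← Finset.mul_sum, sum_inner_mul_inner]
  have ht := LinearMap.trace_eq_sum_inner (fderiv ℝ P z).toLinearMap
    (EuclideanSpace.basisFun (Fin 2) ℝ)
  rw [fenchelOp, ht, hh.apply_inv hr.le] at hF
  simp only [ContinuousLinearMap.coe_coe] at hF
  set T := ∑ i : Fin 2, ⟪EuclideanSpace.basisFun (Fin 2) ℝ i,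
    fderiv ℝ P z (EuclideanSpace.basisFun (Fin 2) ℝ i)⟫
  set S := ⟪fderiv ℝ P z (P z), P z⟫
  set r := ‖P z‖
  set ρ := G r
  set δ := deriv h ρ
  have hkey : ρ / r * T + (δ⁻¹ * r - ρ) / r ^ 3 * S
      = -(1 / (δ * r ^ 2)) * (-(1 - ρ * δ / r) * S - r ^ 2 * (ρ * δ / r) * T) := by
    field_simp
    ring
  rw [hkey]
  have : 0 ≤ 1 / (δ * r ^ 2) := by positivity
  nlinarith [mul_nonneg this hF]

theorem inner_gradient_eq_sum (X : E2) (η : E2 → ℝ) (z : E2) :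
    ⟪X, gradient η z⟫ = ∑ i : Fin 2, ⟪X, EuclideanSpace.basisFun (Fin 2) ℝ i⟫
      * fderiv ℝ η z (EuclideanSpace.basisFun (Fin 2) ℝ i) := by
  rw [← (EuclideanSpace.basisFun (Fin 2) ℝ).sum_inner_mul_inner X (gradient η z)]
  refine Finset.sum_congr rfl fun i _ => ?_
  rw [real_inner_comm (gradient η z), inner_gradient_left]

/-- A smooth strict supersolution is a weak supersolution of the dual equation
(uniformly elliptic case). -/
theorem IsRadialFlux.integral_inner_radial_nonneg {h G : ℝ → ℝ} (hh : IsRadialFlux h G)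
    (hd : ∀ x, 0 < x → 0 < deriv h x) {P : E2 → E2} (hP : ContDiff ℝ 1 P) {x : E2} {s : ℝ}
    (h0 : ∀ z ∈ closedBall x s, P z ≠ 0)
    (hF : ∀ z ∈ closedBall x s,
      0 ≤ fenchelOp (G ‖P z‖ * deriv h (G ‖P z‖) / h (G ‖P z‖)) (P z) (fderiv ℝ P z))
    {D : NNReal} {η : E2 → ℝ} (hη : LipschitzWith D η) (hη0 : ∀ z ∉ ball x s, η z = 0)
    (hηpos : ∀ z, 0 ≤ η z) :
    0 ≤ ∫ z, ⟪(G ‖P z‖ / ‖P z‖) • P z, gradient η z⟫ := by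
  set b := EuclideanSpace.basisFun (Fin 2) ℝ
  have hηc : HasCompactSupport η := HasCompactSupport.intro (isCompact_closedBall x s)
    fun z hz => hη0 z fun h => hz (ball_subset_closedBall h)
  have hgz : ∀ z ∉ ball x s, fderiv ℝ η z = 0 := fun z hz => by
    have := gradient_eq_zero_of_nonneg hηpos (hη0 z hz)
    rwa [gradient, LinearIsometryEquiv.map_eq_zero_iff] at this
  have hcd : ∀ i, ContDiffOn ℝ 1 (fun w => G ‖P w‖ / ‖P w‖ * ⟪P w, b i⟫) (closedBall x s) :=
    fun i => by
      have hn := (hP.contDiffOn (s := closedBall x s)).norm ℝ h0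
      refine ((((hh.contDiffOn_inv fun x hx => (hd x hx).ne').comp hn
        fun z hz => norm_pos_iff.2 (h0 z hz)).div hn
        fun z hz => norm_ne_zero_iff.2 (h0 z hz))).mul ?_
      exact (hP.inner ℝ contDiff_const).contDiffOn
  choose K hK using fun i =>
    (hcd i).exists_lipschitzOnWith one_ne_zero (convex_closedBall x s) (isCompact_closedBall x s)
  choose X hX hXe using fun i => (hK i).extend_real
  have hXf : ∀ i, ∀ z ∈ ball x s, fderiv ℝ (X i) z
      = fderiv ℝ (fun w => G ‖P w‖ / ‖P w‖ * ⟪P w, b i⟫) z := fun i z hz =>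
    (((hXe i).mono ball_subset_closedBall).eventuallyEq_of_mem
      (isOpen_ball.mem_nhds hz)).symm.fderiv_eq
  have hint : ∀ i, Integrable fun z => X i z * fderiv ℝ η z (b i) := fun i => by
    have h1 := integrable_fderiv hη hηc (b i)
    obtain ⟨M, hM⟩ := (isCompact_closedBall x s).exists_bound_of_continuousOn
      (hX i).continuous.continuousOn
    refine (h1.norm.const_mul M).mono'
      ((hX i).continuous.measurable.mul (measurable_fderiv_apply η _)).aestronglyMeasurable
      (Eventually.of_forall fun z => ?_)
    by_cases hz : z ∈ ball x s
    · rw [norm_mul]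
      exact mul_le_mul_of_nonneg_right (hM z (ball_subset_closedBall hz)) (norm_nonneg _)
    · simp [hgz z hz]
  have hint2 : ∀ i, Integrable fun z => fderiv ℝ (X i) z (b i) * η z := fun i => by
    refine (hη.continuous.integrable_of_hasCompactSupport hηc).bdd_mul (c := K i * ‖b i‖)
      (measurable_fderiv_apply (X i) (b i)).aestronglyMeasurable (Eventually.of_forall fun z => ?_)
    exact (ContinuousLinearMap.le_opNorm _ _).trans
      (mul_le_mul_of_nonneg_right (norm_fderiv_le_of_lipschitz ℝ (hX i)) (norm_nonneg _))
  have h1 : ∀ z, ⟪(G ‖P z‖ / ‖P z‖) • P z, gradient η z⟫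
      = ∑ i, X i z * fderiv ℝ η z (b i) := fun z => by
    rw [inner_gradient_eq_sum]
    by_cases hz : z ∈ ball x s
    · refine Finset.sum_congr rfl fun i _ => ?_
      rw [← hXe i (ball_subset_closedBall hz), inner_smul_left]
      simp [b]
    · simp [hgz z hz]
  have h2 : ∫ z, ∑ i, X i z * fderiv ℝ η z (b i) = -∫ z, ∑ i, fderiv ℝ (X i) z (b i) * η z := by
    rw [integral_finsetSum _ fun i _ => hint i, integral_finsetSum _ fun i _ => hint2 i,
      ← Finset.sum_neg_distrib]
    exact Finset.sum_congr rfl fun i _ => by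
      rw [integral_fderiv_mul_eq_neg (hX i) hη hηc (b i), neg_neg]
  simp only [h1]
  rw [h2, ← integral_neg]
  refine integral_nonneg fun z => ?_
  rw [Pi.zero_apply, ← Finset.sum_mul, ← neg_mul]
  by_cases hz : z ∈ ball x s
  · refine mul_nonneg ?_ (hηpos z)
    have hz' := ball_subset_closedBall hz
    simp only [hXf _ z hz]
    exact neg_nonneg.2 (hh.sum_fderiv_radial hd (hP.differentiable one_ne_zero z) (h0 z hz')
      (hF z hz'))
  · simp [hη0 z hz]

theorem LipschitzWith.integrable_norm_gradient {D : NNReal} {η : E2 → ℝ}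
    (hη : LipschitzWith D η) {S : Set E2} (hS : Bornology.IsBounded S)
    (h0 : ∀ z ∉ S, gradient η z = 0) : Integrable fun z => ‖gradient η z‖ := by
  rw [← integrableOn_iff_integrable_of_support_subset (s := S)
    (fun z hz => by by_contra h; exact hz (by simp [h0 z h]))]
  exact Measure.integrableOn_of_bounded (M := D) hS.measure_lt_top.ne
    (measurable_gradient η).norm.aestronglyMeasurable
    (Eventually.of_forall fun z => by simpa using hη.norm_gradient_le z)

namespace IsRadialFlux

variable {h G : ℝ → ℝ}

theorem norm_radial_le (hh : IsRadialFlux h G) (p : E2) : ‖(G ‖p‖ / ‖p‖) • p‖ ≤ G ‖p‖ := by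
  have h1 := hh.inv_nonneg (norm_nonneg p)
  rw [norm_smul, Real.norm_of_nonneg (div_nonneg h1 (norm_nonneg p))]
  by_cases hp : ‖p‖ = 0
  · simpa [hp] using hp ▸ h1
  · rw [div_mul_cancel₀ _ hp]

theorem measurable_inner_radial (hh : IsRadialFlux h G) {P : E2 → E2} (hP : Measurable P)
    (η : E2 → ℝ) : Measurable fun z => ⟪(G ‖P z‖ / ‖P z‖) • P z, gradient η z⟫ :=
  (((hh.measurable_inv_comp hP.norm fun _ => norm_nonneg _).div hP.norm).smul hP).inner
    (measurable_gradient η)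

theorem norm_inner_radial_le (hh : IsRadialFlux h G) {P : E2 → E2} {M : ℝ} {S : Set E2}
    (hM : ∀ z ∈ S, ‖P z‖ ≤ M) {η : E2 → ℝ} (h0 : ∀ z ∉ S, gradient η z = 0) (z : E2) :
    ‖⟪(G ‖P z‖ / ‖P z‖) • P z, gradient η z⟫‖ ≤ G M * ‖gradient η z‖ := by
  by_cases hz : z ∈ S
  · refine (norm_inner_le_norm _ _).trans (mul_le_mul_of_nonneg_right ?_ (norm_nonneg _))
    exact (hh.norm_radial_le _).trans (hh.inv_strictMonoOn.monotoneOn (norm_nonneg _)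
      ((norm_nonneg _).trans (hM z hz)) (hM z hz))
  · simp [h0 z hz]

theorem integrable_inner_radial (hh : IsRadialFlux h G) {P : E2 → E2} (hP : Measurable P)
    {M : ℝ} {S : Set E2} (hS : Bornology.IsBounded S) (hM : ∀ z ∈ S, ‖P z‖ ≤ M)
    {D : NNReal} {η : E2 → ℝ} (hη : LipschitzWith D η) (h0 : ∀ z ∉ S, gradient η z = 0) :
    Integrable fun z => ⟪(G ‖P z‖ / ‖P z‖) • P z, gradient η z⟫ :=
  ((hη.integrable_norm_gradient hS h0).const_mul (G M)).mono'
    (hh.measurable_inner_radial hP η).aestronglyMeasurable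
    (Eventually.of_forall (hh.norm_inner_radial_le hM h0))

/-- A smooth supersolution of all small uniformly elliptic regularizations is a weak
supersolution of the dual equation. -/
theorem integral_inner_radial_nonneg_of_reg (hh : IsRadialFlux h G) {P : E2 → E2}
    (hP : ContDiff ℝ 1 P) {x : E2} {s : ℝ} (h0 : ∀ z ∈ closedBall x s, P z ≠ 0)
    {ε₀ : ℝ} (hε₀ : 0 < ε₀)
    (hF : ∀ ε, 0 < ε → ε ≤ ε₀ → ∀ z ∈ closedBall x s, 0 ≤ fenchelOp
      (regInv h ε ‖P z‖ * (deriv h (regInv h ε ‖P z‖) + ε) / ‖P z‖) (P z) (fderiv ℝ P z))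
    {D : NNReal} {η : E2 → ℝ} (hη : LipschitzWith D η) (hη0 : ∀ z ∉ ball x s, η z = 0)
    (hηpos : ∀ z, 0 ≤ η z) :
    0 ≤ ∫ z, ⟪(G ‖P z‖ / ‖P z‖) • P z, gradient η z⟫ := by
  set ε : ℕ → ℝ := fun n => ε₀ * (1 / ((n : ℝ) + 1)) with hε
  have hεpos : ∀ n, 0 < ε n := fun n => by positivity
  have hεlim : Tendsto ε atTop (𝓝 0) := by
    have := (tendsto_one_div_add_atTop_nhds_zero_nat (𝕜 := ℝ)).const_mul ε₀
    rwa [mul_zero] at this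
  have hεle : ∀ n, ε n ≤ ε₀ := fun n => mul_le_of_le_one_right hε₀.le (by
    rw [div_le_one (by positivity)]
    have : (0 : ℝ) ≤ n := n.cast_nonneg
    linarith)
  have hreg := fun n => hh.add_mul (hεpos n).le
  have hgz : ∀ z ∉ closedBall x s, gradient η z = 0 := fun z hz =>
    gradient_eq_zero_of_nonneg hηpos (hη0 z fun h => hz (ball_subset_closedBall h))
  obtain ⟨M, hM⟩ := (isCompact_closedBall x s).exists_bound_of_continuousOn
    hP.continuous.continuousOn
  refine ge_of_tendsto' (tendsto_integral_of_dominated_convergence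
    (F := fun n z => ⟪(regInv h (ε n) ‖P z‖ / ‖P z‖) • P z, gradient η z⟫)
    (fun z => G M * ‖gradient η z‖) (fun n => ?_) ?_ (fun n => ?_) ?_) fun n => ?_
  · exact ((hreg n).measurable_inner_radial hP.continuous.measurable η).aestronglyMeasurable
  · exact (hη.integrable_norm_gradient isBounded_closedBall hgz).const_mul _
  · refine Eventually.of_forall fun z => ?_
    by_cases hz : z ∈ closedBall x s
    · refine ((hreg n).norm_inner_radial_le hM hgz z).trans
        (mul_le_mul_of_nonneg_right ?_ (norm_nonneg _))
      exact hh.inv_add_mul_le (hεpos n).le ((norm_nonneg _).trans (hM z hz))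
    · simp [hgz z hz]
  · refine Eventually.of_forall fun z => ?_
    simp only [inner_smul_left, RCLike.conj_to_real]
    exact ((hh.tendsto_inv_add_mul (fun n => (hεpos n).le) hεlim (norm_nonneg _)).div_const
      _).mul_const _
  · have hder : ∀ y, 0 < y → deriv (fun ρ => h ρ + ε n * ρ) y = deriv h y + ε n := fun y hy => by
      have := (hh.differentiableAt hy).hasDerivAt.add ((hasDerivAt_id y).const_mul (ε n))
      rw [mul_one] at this
      exact this.deriv
    refine (hreg n).integral_inner_radial_nonneg (fun y hy => ?_) hP h0 (fun z hz => ?_) hη hη0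
      hηpos
    · rw [hder y hy]
      linarith [hh.deriv_nonneg hy, hεpos n]
    · have hr := norm_pos_iff.2 (h0 z hz)
      rw [hder _ ((hreg n).inv_pos hr), (hreg n).apply_inv hr.le]
      exact hF _ (hεpos n) (hεle n) z hz

theorem radial_rotFlux (hh : IsRadialFlux h G) (p : E2) :
    (G ‖rotFlux h p‖ / ‖rotFlux h p‖) • rotFlux h p = !₂[-p 1, p 0] := by
  have h1 : 0 ≤ h ‖p‖ := hh.bijOn.mapsTo (norm_nonneg p)
  rw [norm_rotFlux hh.zero p h1, hh.inv_apply (norm_nonneg p)]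
  by_cases hp : p = 0
  · subst hp
    ext i
    fin_cases i <;> simp
  · have hr : 0 < ‖p‖ := norm_pos_iff.2 hp
    have h2 : 0 < h ‖p‖ := by
      have := hh.strictMonoOn self_mem_Ici (norm_nonneg p) hr
      rwa [hh.zero] at this
    rw [rotFlux, smul_smul, div_mul_div_cancel₀ h2.ne', div_self hr.ne', one_smul]

/-- Stream functions solve the dual equation weakly. -/
theorem integral_inner_radial_eq_zero (hh : IsRadialFlux h G) {u v : E2 → ℝ} {C D : NNReal}
    (hu : LipschitzWith C u) {S : Set E2}
    (huv : ∀ᵐ z, z ∈ S → gradient v z = rotFlux h (gradient u z)) {η : E2 → ℝ}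
    (hη : LipschitzWith D η) (hηc : HasCompactSupport η) (h0 : ∀ z ∉ S, gradient η z = 0) :
    ∫ z, ⟪(G ‖gradient v z‖ / ‖gradient v z‖) • gradient v z, gradient η z⟫ = 0 := by
  set b := EuclideanSpace.basisFun (Fin 2) ℝ with hb
  have hg : ∀ (w : E2 → ℝ) (z : E2) (i : Fin 2), gradient w z i = fderiv ℝ w z (b i) :=
    fun w z i => by
      rw [← inner_gradient_left, hb, EuclideanSpace.basisFun_apply,
        EuclideanSpace.inner_single_right]
      simp
  have hbd : ∀ i z, ‖fderiv ℝ u z (b i)‖ ≤ C * ‖b i‖ := fun i z =>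
    (ContinuousLinearMap.le_opNorm _ _).trans
      (mul_le_mul_of_nonneg_right (norm_fderiv_le_of_lipschitz ℝ hu) (norm_nonneg _))
  have hI : ∀ i j, Integrable fun z => fderiv ℝ u z (b i) * fderiv ℝ η z (b j) := fun i j =>
    integrable_bdd_mul_fderiv hη hηc (measurable_fderiv_apply u _) (hbd i) _
  have h1 : ∀ᵐ z, ⟪(G ‖gradient v z‖ / ‖gradient v z‖) • gradient v z, gradient η z⟫
      = fderiv ℝ u z (b 0) * fderiv ℝ η z (b 1) - fderiv ℝ u z (b 1) * fderiv ℝ η z (b 0) := by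
    filter_upwards [huv] with z hz
    rw [← hg, ← hg, ← hg, ← hg]
    by_cases hzS : z ∈ S
    · rw [hz hzS, hh.radial_rotFlux, PiLp.inner_apply]
      simp [Fin.sum_univ_two]
      ring
    · simp [h0 z hzS]
  rw [integral_congr_ae h1, integral_sub (hI 0 1) (hI 1 0),
    integral_fderiv_mul_fderiv_comm hu hη hηc, sub_self]

/-- Comparison of a stream function with a smooth supersolution on a ball. -/
theorem sub_le_of_forall_sphere (hh : IsRadialFlux h G) {u v : E2 → ℝ} {C C' : NNReal}
    (hu : LipschitzWith C u) (hv : LipschitzWith C' v) {x : E2} {s : ℝ} (hs : 0 < s)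
    (huv : ∀ᵐ z, z ∈ ball x s → gradient v z = rotFlux h (gradient u z))
    {φ : E2 → ℝ} (hφ : ContDiff ℝ 2 φ) (h0 : ∀ z ∈ closedBall x s, gradient φ z ≠ 0)
    {ε₀ : ℝ} (hε₀ : 0 < ε₀)
    (hF : ∀ ε, 0 < ε → ε ≤ ε₀ → ∀ z ∈ closedBall x s, 0 ≤ fenchelOp
      (regInv h ε ‖gradient φ z‖ * (deriv h (regInv h ε ‖gradient φ z‖) + ε) / ‖gradient φ z‖)
      (gradient φ z) (fderiv ℝ (gradient φ) z))
    {c : ℝ} (hc : ∀ z ∈ sphere x s, v z - φ z ≤ c) : v x - φ x ≤ c := by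
  have hP : ContDiff ℝ 1 (gradient φ) :=
    (InnerProductSpace.toDual ℝ E2).symm.contDiff.comp (hφ.fderiv_right (by norm_num))
  obtain ⟨K, hK⟩ := (hφ.contDiffOn (s := closedBall x s)).exists_lipschitzOnWith two_ne_zero
    (convex_closedBall x s) (isCompact_closedBall x s)
  obtain ⟨w, hw, hφw⟩ := hK.extend_real
  have hH : LipschitzWith _ fun z => max (v z - w z - c) 0 :=
    ((hv.sub hw).sub (LipschitzWith.const c)).max_const 0
  set η := (ball x s).indicator fun z => max (v z - w z - c) 0 with hηdef
  have hη : LipschitzWith _ η := hH.indicator_of_frontier fun z hz => by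
    have hz' := frontier_ball_subset_sphere hz
    rw [← hφw (sphere_subset_closedBall hz')]
    exact max_eq_right (by linarith [hc z hz'])
  have hη0 : ∀ z ∉ ball x s, η z = 0 := fun z hz => indicator_of_notMem hz _
  have hηpos : ∀ z, 0 ≤ η z := fun z => indicator_nonneg (fun _ _ => le_max_right _ _) z
  have hηc : HasCompactSupport η := HasCompactSupport.intro (isCompact_closedBall x s)
    fun z hz => hη0 z fun h => hz (ball_subset_closedBall h)
  have hgz : ∀ z ∉ ball x s, gradient η z = 0 := fun z hz =>
    gradient_eq_zero_of_nonneg hηpos (hη0 z hz)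
  have hgη : ∀ᵐ z, gradient η z = 0 ∨ gradient η z = gradient v z - gradient φ z := by
    filter_upwards [hv.ae_differentiableAt] with z hvz
    rcases (hηpos z).eq_or_lt with h | h
    · exact Or.inl (gradient_eq_zero_of_nonneg hηpos h.symm)
    · right
      have hzb : z ∈ ball x s := by
        by_contra hzb
        exact h.ne' (hη0 z hzb)
      have hev : η =ᶠ[𝓝 z] fun y => v y - φ y - c := by
        filter_upwards [isOpen_ball.mem_nhds hzb,
          hη.continuous.continuousAt.eventually (lt_mem_nhds h)] with y hy hy'
        rw [hηdef, indicator_of_mem hy] at hy' ⊢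
        simp only [lt_max_iff, lt_irrefl, or_false] at hy'
        rw [hφw (ball_subset_closedBall hy)]
        exact max_eq_left hy'.le
      rw [hev.gradient_eq, gradient_sub_const, gradient_sub_of_differentiableAt hvz
        (hφ.differentiable two_ne_zero z)]
  obtain ⟨M, hM⟩ := (isCompact_closedBall x s).exists_bound_of_continuousOn
    hP.continuous.continuousOn
  have i1 := hh.integrable_inner_radial (measurable_gradient v) isBounded_ball
    (fun z _ => hv.norm_gradient_le z) hη hgz
  have i2 := hh.integrable_inner_radial (measurable_gradient φ) isBounded_ball
    (fun z hz => hM z (ball_subset_closedBall hz)) hη hgz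
  have e1 := hh.integral_inner_radial_eq_zero hu huv hη hηc hgz
  have e2 := hh.integral_inner_radial_nonneg_of_reg hP h0 hε₀ hF hη hη0 hηpos
  have hN : ∀ᵐ z, 0 ≤ ⟪(G ‖gradient v z‖ / ‖gradient v z‖) • gradient v z, gradient η z⟫
      - ⟪(G ‖gradient φ z‖ / ‖gradient φ z‖) • gradient φ z, gradient η z⟫ ∧
      (gradient η z ≠ 0 →
      0 < ⟪(G ‖gradient v z‖ / ‖gradient v z‖) • gradient v z, gradient η z⟫
      - ⟪(G ‖gradient φ z‖ / ‖gradient φ z‖) • gradient φ z, gradient η z⟫) := by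
    filter_upwards [hgη] with z hz
    by_cases hg : gradient η z = 0
    · simp [hg]
    · rw [or_iff_right hg] at hz
      have := hh.inner_sub_pos (p := gradient v z) (q := gradient φ z)
        (sub_ne_zero.1 (hz ▸ hg))
      rw [← inner_sub_left, hz]
      exact ⟨this.le, fun _ => this⟩
  have hint : ∫ z, (⟪(G ‖gradient v z‖ / ‖gradient v z‖) • gradient v z, gradient η z⟫
      - ⟪(G ‖gradient φ z‖ / ‖gradient φ z‖) • gradient φ z, gradient η z⟫) = 0 := by
    refine le_antisymm ?_ (integral_nonneg_of_ae (hN.mono fun z hz => hz.1))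
    rw [integral_sub i1 i2, e1]
    linarith
  rw [integral_eq_zero_iff_of_nonneg_ae (hN.mono fun z hz => hz.1) (i1.sub i2)] at hint
  have hη_zero := eq_zero_of_ae_gradient_eq_zero hη hηc (by
    filter_upwards [hint, hN] with z h1 h2
    by_contra h3
    exact (h2.2 h3).ne' h1) x
  rw [hηdef, indicator_of_mem (mem_ball_self hs)] at hη_zero
  have := max_eq_right_iff.1 hη_zero
  rw [← hφw (mem_closedBall_self hs.le)] at this
  linarith

end IsRadialFlux

/-- `ρ` maximizes `ρ ↦ ρ r − f ρ` on `[0,∞)`. -/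
structure IsFenchelArg (f : ℝ → ℝ) (r ρ : ℝ) : Prop where
  nonneg : 0 ≤ ρ
  le_dtop : r ≤ dtop f ρ
  eq_zero_or : ρ = 0 ∨ dtop f ρ = r

namespace IsFenchelArg

variable {f : ℝ → ℝ}

theorem exists_of_unbounded (h1 : ContDiffOn ℝ 1 f (Ici 0)) {r : ℝ}
    (hub : ∃ ρ, 0 ≤ ρ ∧ r < dtop f ρ) : ∃ ρ, IsFenchelArg f r ρ := by
  by_cases h0 : r ≤ dtop f 0
  · exact ⟨0, le_rfl, h0, Or.inl rfl⟩
  · obtain ⟨R, hR, hRr⟩ := hub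
    obtain ⟨ρ, hρ, rfl⟩ := intermediate_value_Icc hR
      ((continuousOn_dtop h1).mono Icc_subset_Ici_self) ⟨(not_le.1 h0).le, hRr.le⟩
    exact ⟨ρ, hρ.1, le_rfl, Or.inr rfl⟩

theorem lt_dtop {r ρ x : ℝ} (h : IsFenchelArg f r ρ) (hf : StrictConvexOn ℝ (Ici 0) f)
    (h1 : ContDiffOn ℝ 1 f (Ici 0)) (hx : ρ < x) : r < dtop f x :=
  h.le_dtop.trans_lt (strictMonoOn_dtop hf h1 h.nonneg (h.nonneg.trans hx.le) hx)

theorem dtop_lt {r ρ x : ℝ} (h : IsFenchelArg f r ρ) (hf : StrictConvexOn ℝ (Ici 0) f)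
    (h1 : ContDiffOn ℝ 1 f (Ici 0)) (hx0 : 0 ≤ x) (hx : x < ρ) : dtop f x < r := by
  rcases h.eq_zero_or with h0 | h0
  · linarith
  · rw [← h0]
    exact strictMonoOn_dtop hf h1 hx0 h.nonneg hx

theorem le_of_lt_dtop {r ρ x : ℝ} (h : IsFenchelArg f r ρ) (hf : StrictConvexOn ℝ (Ici 0) f)
    (h1 : ContDiffOn ℝ 1 f (Ici 0)) (hx : 0 ≤ x) (hr : r < dtop f x) : ρ ≤ x := by
  by_contra! hlt
  exact (h.dtop_lt hf h1 hx hlt).not_gt hr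

theorem le_of_dtop_lt {r ρ x : ℝ} (h : IsFenchelArg f r ρ) (hf : StrictConvexOn ℝ (Ici 0) f)
    (h1 : ContDiffOn ℝ 1 f (Ici 0)) (hr : dtop f x < r) : x ≤ ρ := by
  by_contra! hlt
  exact (h.lt_dtop hf h1 hlt).not_gt hr

theorem isGreatest {r ρ : ℝ} (h : IsFenchelArg f r ρ) (hf : StrictConvexOn ℝ (Ici 0) f)
    (h1 : ContDiffOn ℝ 1 f (Ici 0)) :
    IsGreatest ((fun x => x * r - f x) '' Ici 0) (ρ * r - f ρ) := by
  refine ⟨⟨ρ, h.nonneg, rfl⟩, ?_⟩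
  rintro _ ⟨x, hx, rfl⟩
  have h2 := add_dtop_mul_le hf h1 h.nonneg hx
  have h3 : r * (x - ρ) ≤ dtop f ρ * (x - ρ) := by
    rcases h.eq_zero_or with h0 | h0
    · subst h0
      rw [sub_zero]
      exact mul_le_mul_of_nonneg_right h.le_dtop hx
    · rw [h0]
  simp only
  linarith

theorem fenchel_eq {r ρ : ℝ} (h : IsFenchelArg f r ρ) (hf : StrictConvexOn ℝ (Ici 0) f)
    (h1 : ContDiffOn ℝ 1 f (Ici 0)) : fenchel f r = ρ * r - f ρ :=
  (h.isGreatest hf h1).csSup_eq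

theorem fenchel_add_le {r s ρ τ : ℝ} (h : IsFenchelArg f r ρ) (h' : IsFenchelArg f s τ)
    (hf : StrictConvexOn ℝ (Ici 0) f) (h1 : ContDiffOn ℝ 1 f (Ici 0)) :
    fenchel f r + ρ * (s - r) ≤ fenchel f s := by
  have := (h'.isGreatest hf h1).2 ⟨ρ, h.nonneg, rfl⟩
  rw [h.fenchel_eq hf h1, h'.fenchel_eq hf h1]
  simp only at this
  linarith

theorem hasDerivAt_fenchel {r ρ : ℝ} (h : IsFenchelArg f r ρ) (hf : StrictConvexOn ℝ (Ici 0) f)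
    (h1 : ContDiffOn ℝ 1 f (Ici 0)) (hub : ∀ r, ∃ ρ, 0 ≤ ρ ∧ r < dtop f ρ) :
    HasDerivAt (fenchel f) ρ r := by
  choose τ hτ using fun s => exists_of_unbounded h1 (hub s)
  rw [hasDerivAt_iff_isLittleO, Asymptotics.isLittleO_iff]
  intro ε hε
  have hup : ∀ᶠ s in 𝓝 r, τ s ≤ ρ + ε :=
    (gt_mem_nhds (h.lt_dtop hf h1 (lt_add_of_pos_right ρ hε))).mono fun s hs =>
      (hτ s).le_of_lt_dtop hf h1 (by linarith [h.nonneg]) hs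
  have hlow : ∀ᶠ s in 𝓝 r, ρ - ε ≤ τ s := by
    rcases lt_or_ge (ρ - ε) 0 with h0 | h0
    · exact Eventually.of_forall fun s => h0.le.trans (hτ s).nonneg
    · exact (lt_mem_nhds (h.dtop_lt hf h1 h0 (sub_lt_self ρ hε))).mono fun s hs =>
        (hτ s).le_of_dtop_lt hf h1 hs
  filter_upwards [hup, hlow] with s hs1 hs2
  have e1 := h.fenchel_add_le (hτ s) hf h1
  have e2 := (hτ s).fenchel_add_le h hf h1
  rw [smul_eq_mul, Real.norm_of_nonneg (by linarith), Real.norm_eq_abs]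
  have e3 : |τ s - ρ| ≤ ε := abs_le.2 ⟨by linarith, by linarith⟩
  calc fenchel f s - fenchel f r - (s - r) * ρ ≤ (τ s - ρ) * (s - r) := by linarith
    _ ≤ |τ s - ρ| * |s - r| := by rw [← abs_mul]; exact le_abs_self _
    _ ≤ ε * |s - r| := mul_le_mul_of_nonneg_right e3 (abs_nonneg _)

theorem dtop_fenchel {r : ℝ} (hr : 0 < r) (hf : StrictConvexOn ℝ (Ici 0) f)
    (h1 : ContDiffOn ℝ 1 f (Ici 0)) (hub : ∀ r, ∃ ρ, 0 ≤ ρ ∧ r < dtop f ρ) :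
    IsFenchelArg f r (dtop (fenchel f) r) := by
  obtain ⟨ρ, hρ⟩ := exists_of_unbounded h1 (hub r)
  rwa [dtop, derivWithin_of_mem_nhds (Ici_mem_nhds hr),
    (hρ.hasDerivAt_fenchel hf h1 hub).deriv]

end IsFenchelArg

/-- The derivative of a uniform limit of convex functions with unbounded derivatives is
unbounded. -/
theorem exists_lt_dtop_of_tendstoUniformlyOn {f : ℝ → ℝ} {fa : ℕ → ℝ → ℝ}
    (hf : StrictConvexOn ℝ (Ici 0) f) (h1 : ContDiffOn ℝ 1 f (Ici 0))
    (hfa : ∀ a, StrictConvexOn ℝ (Ici 0) (fa a)) (h1a : ∀ a, ContDiffOn ℝ 1 (fa a) (Ici 0))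
    (hsurj : ∀ a, SurjOn (dtop (fa a)) (Ici 0) (Ici 0))
    (hunif : TendstoUniformlyOn (fun a ρ => fa a ρ) f atTop (Ici 0)) (r : ℝ) :
    ∃ ρ, 0 ≤ ρ ∧ r < dtop f ρ := by
  obtain ⟨a, ha⟩ := (Metric.tendstoUniformlyOn_iff.1 hunif 1 one_pos).exists
  obtain ⟨x, hx, hxr⟩ := hsurj a (show |r| + 2 ∈ Ici (0 : ℝ) by rw [mem_Ici]; positivity)
  have hx' : (0 : ℝ) ≤ x := hx
  refine ⟨x + 1, by linarith, ?_⟩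
  have e1 := dtop_mul_lt_sub (hfa a) (h1a a) hx (lt_add_one x)
  have e2 := sub_lt_dtop_mul hf h1 hx (lt_add_one x)
  have e3 := abs_lt.1 (ha x hx)
  have e4 := abs_lt.1 (ha (x + 1) (show (0 : ℝ) ≤ x + 1 by linarith))
  rw [hxr] at e1
  linarith [le_abs_self r]

section Convergence

variable {f : ℝ → ℝ} {fa : ℕ → ℝ → ℝ}

theorem eventually_lt_dtop (hf : StrictConvexOn ℝ (Ici 0) f) (h1 : ContDiffOn ℝ 1 f (Ici 0))
    (hfa : ∀ a, StrictConvexOn ℝ (Ici 0) (fa a)) (h1a : ∀ a, ContDiffOn ℝ 1 (fa a) (Ici 0))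
    (hlim : ∀ ρ, 0 ≤ ρ → Tendsto (fun a => fa a ρ) atTop (𝓝 (f ρ))) {x y c : ℝ} (hx : 0 ≤ x)
    (hxy : x < y) (hc : c < dtop f x) : ∀ᶠ a in atTop, c < dtop (fa a) y := by
  have e1 := dtop_mul_lt_sub hf h1 hx hxy
  have e2 := mul_lt_mul_of_pos_right hc (sub_pos.2 hxy)
  filter_upwards [((hlim y (hx.trans hxy.le)).sub (hlim x hx)).eventually
    (lt_mem_nhds (e2.trans e1))] with a ha
  exact lt_of_mul_lt_mul_right (ha.trans (sub_lt_dtop_mul (hfa a) (h1a a) hx hxy))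
    (sub_pos.2 hxy).le

theorem eventually_dtop_lt (hf : StrictConvexOn ℝ (Ici 0) f) (h1 : ContDiffOn ℝ 1 f (Ici 0))
    (hfa : ∀ a, StrictConvexOn ℝ (Ici 0) (fa a)) (h1a : ∀ a, ContDiffOn ℝ 1 (fa a) (Ici 0))
    (hlim : ∀ ρ, 0 ≤ ρ → Tendsto (fun a => fa a ρ) atTop (𝓝 (f ρ))) {x y c : ℝ} (hx : 0 ≤ x)
    (hxy : x < y) (hc : dtop f y < c) : ∀ᶠ a in atTop, dtop (fa a) x < c := by
  have e1 := sub_lt_dtop_mul hf h1 hx hxy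
  have e2 := mul_lt_mul_of_pos_right hc (sub_pos.2 hxy)
  filter_upwards [((hlim y (hx.trans hxy.le)).sub (hlim x hx)).eventually
    (gt_mem_nhds (e1.trans e2))] with a ha
  exact lt_of_mul_lt_mul_right ((dtop_mul_lt_sub (hfa a) (h1a a) hx hxy).trans ha)
    (sub_pos.2 hxy).le

theorem IsFenchelArg.exists_eventually_dtop {r₀ ρ₀ : ℝ} (h : IsFenchelArg f r₀ ρ₀)
    (hf : StrictConvexOn ℝ (Ici 0) f) (h1 : ContDiffOn ℝ 1 f (Ici 0))
    (hfa : ∀ a, StrictConvexOn ℝ (Ici 0) (fa a)) (h1a : ∀ a, ContDiffOn ℝ 1 (fa a) (Ici 0))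
    (hlim : ∀ ρ, 0 ≤ ρ → Tendsto (fun a => fa a ρ) atTop (𝓝 (f ρ))) {δ : ℝ} (hδ : 0 < δ) :
    ∃ s > 0, ∀ᶠ a in atTop, r₀ + s < dtop (fa a) (ρ₀ + δ) ∧
      (0 ≤ ρ₀ - δ → dtop (fa a) (ρ₀ - δ) < r₀ - s) := by
  have hup : r₀ < dtop f (ρ₀ + δ / 2) := h.lt_dtop hf h1 (by linarith)
  have hlow : ∃ s > 0, 0 ≤ ρ₀ - δ → dtop f (ρ₀ - δ / 2) < r₀ - s := by
    by_cases h0 : 0 ≤ ρ₀ - δ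
    · have := h.dtop_lt hf h1 (show 0 ≤ ρ₀ - δ / 2 by linarith) (by linarith)
      exact ⟨(r₀ - dtop f (ρ₀ - δ / 2)) / 2, by linarith, fun _ => by linarith⟩
    · exact ⟨1, one_pos, fun h' => absurd h' h0⟩
  obtain ⟨s₁, hs₁, hlow⟩ := hlow
  set s₂ := (dtop f (ρ₀ + δ / 2) - r₀) / 2 with hs₂
  have hs₂' : 0 < s₂ := by linarith
  refine ⟨min s₁ s₂, lt_min hs₁ hs₂', ?_⟩
  have hρ := h.nonneg
  have e1 := eventually_lt_dtop hf h1 hfa h1a hlim (c := r₀ + s₂)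
    (show 0 ≤ ρ₀ + δ / 2 by linarith) (show ρ₀ + δ / 2 < ρ₀ + δ by linarith) (by linarith)
  have e2 : ∀ᶠ a in atTop, 0 ≤ ρ₀ - δ → dtop (fa a) (ρ₀ - δ) < r₀ - s₁ := by
    by_cases h0 : 0 ≤ ρ₀ - δ
    · filter_upwards [eventually_dtop_lt hf h1 hfa h1a hlim h0
        (show ρ₀ - δ < ρ₀ - δ / 2 by linarith) (hlow h0)] with a ha _ using ha
    · exact Eventually.of_forall fun a h' => absurd h' h0
  filter_upwards [e1, e2] with a h3 h4
  exact ⟨by linarith [min_le_right s₁ s₂], fun h0 => by linarith [h4 h0, min_le_left s₁ s₂]⟩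

theorem IsRadialFlux.regInv_param_sub {h G : ℝ → ℝ} (hh : IsRadialFlux h G) {ε r : ℝ}
    (hε : 0 ≤ ε) (hr : 0 < r) :
    regInv h ε r * (deriv h (regInv h ε r) + ε) / r
        - regInv h ε r * deriv h (regInv h ε r) / h (regInv h ε r)
      = ε * regInv h ε r
        * (1 - regInv h ε r * deriv h (regInv h ε r) / h (regInv h ε r)) / r := by
  have h1 := (hh.add_mul hε).inv_pos hr
  have h2 : h (regInv h ε r) + ε * regInv h ε r = r := (hh.add_mul hε).apply_inv hr.le
  have h3 : 0 < h (regInv h ε r) := by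
    simpa [hh.zero] using hh.strictMonoOn self_mem_Ici h1.le h1
  set ρ := regInv h ε r
  rw [← h2] at hr ⊢
  have := hr.ne'
  field_simp
  ring

theorem IsFenchelArg.eventually_abs_regInv_param_sub_le {r₀ ρ₀ : ℝ} (h : IsFenchelArg f r₀ ρ₀)
    (hr₀ : 0 < r₀) (hf : StrictConvexOn ℝ (Ici 0) f) (h1 : ContDiffOn ℝ 1 f (Ici 0))
    (hfa : ∀ a, StrictConvexOn ℝ (Ici 0) (fa a)) (h1a : ∀ a, ContDiffOn ℝ 1 (fa a) (Ici 0))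
    {gpa : ℕ → ℝ → ℝ} (hh : ∀ a, IsRadialFlux (dtop (fa a)) (gpa a))
    (hlim : ∀ ρ, 0 ≤ ρ → Tendsto (fun a => fa a ρ) atTop (𝓝 (f ρ)))
    {α : ℝ → ℝ} (hα : ContinuousWithinAt α (Ici 0) ρ₀)
    {αa : ℕ → ℝ → ℝ}
    (hαa : ∀ a, ∀ ρ : ℝ, ρ ≠ 0 → αa a ρ = ρ * deriv (dtop (fa a)) ρ / dtop (fa a) ρ)
    (hαunif : ∀ K : Set ℝ, IsCompact K → K ⊆ Ici 0 → TendstoUniformlyOn αa α atTop K)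
    {δ : ℝ} (hδ : 0 < δ) :
    ∃ s > 0, ∃ ε₀ > 0, ∀ᶠ a in atTop, ∀ ε, 0 < ε → ε ≤ ε₀ → ∀ r, |r - r₀| ≤ s →
      |regInv (dtop (fa a)) ε r * (deriv (dtop (fa a)) (regInv (dtop (fa a)) ε r) + ε) / r
        - α ρ₀| ≤ δ := by
  obtain ⟨η, hη, hcont⟩ := Metric.continuousWithinAt_iff.1 hα (δ / 4) (by linarith)
  set δ' := η / 2 with hδ'
  have hδ'0 : 0 < δ' := by positivity
  have hρ₀ := h.nonneg
  obtain ⟨s, hs, hev⟩ := h.exists_eventually_dtop hf h1 hfa h1a hlim hδ'0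
  set M := 1 + |α ρ₀| + δ / 2 with hM
  have hM0 : 0 < M := by positivity
  have hR : 0 < ρ₀ + δ' := by positivity
  have hu := Metric.tendstoUniformlyOn_iff.1
    (hαunif (Icc 0 (ρ₀ + δ')) isCompact_Icc Icc_subset_Ici_self) (δ / 4) (by linarith)
  refine ⟨min (s / 2) (r₀ / 2), by positivity,
    min (s / 2) (δ / 2 * (r₀ / 2) / M) / (ρ₀ + δ'), by positivity, ?_⟩
  filter_upwards [hev, hu] with a ⟨hup, hlow⟩ hua ε hε hε₀ r hr
  rw [le_div_iff₀ hR, le_min_iff, le_div_iff₀ hM0] at hε₀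
  rw [le_min_iff, abs_le, abs_le] at hr
  have hr0 : 0 < r := by linarith [hr.2.1]
  have hhε := (hh a).add_mul hε.le
  have hρ := hhε.inv_pos hr0
  have hid := (hh a).regInv_param_sub hε.le hr0
  set ρ := regInv (dtop (fa a)) ε r with hρdef
  have hρup : ρ < ρ₀ + δ' := by
    rw [hρdef, hhε.inv_lt_iff hR.le hr0.le]
    nlinarith [mul_nonneg hε.le hR.le, hr.1.2]
  have hρlow : ρ₀ - δ' ≤ ρ := by
    rcases lt_or_ge (ρ₀ - δ') 0 with h0 | h0
    · linarith
    · refine le_of_lt ?_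
      rw [hρdef, hhε.lt_inv_iff h0 hr0.le]
      have : ε * (ρ₀ - δ') ≤ ε * (ρ₀ + δ') := by gcongr; linarith
      linarith [hlow h0, hr.1.1]
  rw [← hαa a ρ hρ.ne'] at hid
  have e1 : |αa a ρ - α ρ| < δ / 4 := by
    rw [abs_sub_comm]
    exact hua ρ ⟨hρ.le, hρup.le⟩
  have e2 : |α ρ - α ρ₀| < δ / 4 := hcont hρ.le (by
    rw [Real.dist_eq]
    exact (abs_le.2 ⟨by linarith, by linarith⟩).trans_lt (half_lt_self hη))
  have e3 : |αa a ρ - α ρ₀| ≤ δ / 2 :=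
    (abs_sub_le _ (α ρ) _).trans (by linarith)
  have e4 : |1 - αa a ρ| ≤ M := by
    calc |1 - αa a ρ| = |1 - α ρ₀ - (αa a ρ - α ρ₀)| := by congr 1; ring
      _ ≤ |1 - α ρ₀| + |αa a ρ - α ρ₀| := abs_sub _ _
      _ ≤ (|1| + |α ρ₀|) + δ / 2 := add_le_add (abs_sub _ _) e3
      _ = M := by rw [abs_one]
  have e5 : |ε * ρ * (1 - αa a ρ) / r| ≤ δ / 2 := by
    rw [abs_div, abs_mul, abs_of_pos hr0, abs_of_pos (mul_pos hε hρ), div_le_iff₀ hr0]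
    calc ε * ρ * |1 - αa a ρ| ≤ ε * (ρ₀ + δ') * M := by gcongr
      _ ≤ δ / 2 * (r₀ / 2) := hε₀.2
      _ ≤ δ / 2 * r := by gcongr; linarith [hr.2.1]
  rw [← hid] at e5
  calc |ρ * (deriv (dtop (fa a)) ρ + ε) / r - α ρ₀| ≤ _ := abs_sub_le _ (αa a ρ) _
    _ ≤ δ / 2 + δ / 2 := add_le_add e5 e3
    _ = δ := by ring

theorem isRadialFlux_dtop {k G : ℝ → ℝ} (h1 : ContDiffOn ℝ 1 k (Ici 0))
    (h2 : ContDiffOn ℝ 2 k (Ioi 0)) (h0 : dtop k 0 = 0) (hm : StrictMonoOn (dtop k) (Ici 0))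
    (hb : BijOn (dtop k) (Ici 0) (Ici 0)) (hinv : InvOn G (dtop k) (Ici 0) (Ici 0)) :
    IsRadialFlux (dtop k) G :=
  ⟨h0, continuousOn_dtop h1, (h2.deriv_of_isOpen isOpen_Ioi (by norm_num)).congr fun x hx => by
    rw [dtop, derivWithin_of_mem_nhds (Ici_mem_nhds hx)], hm, hb, hinv⟩

theorem IsRadialFlux.continuousOn_of_eq_elasticity {h G β : ℝ → ℝ} (hh : IsRadialFlux h G)
    (hβ : ∀ ρ : ℝ, ρ ≠ 0 → β ρ = ρ * deriv h ρ / h ρ)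
    (hβ0 : Tendsto (fun ρ => ρ * deriv h ρ / h ρ) (𝓝[>] 0) (𝓝 (β 0))) :
    ContinuousOn β (Ici 0) := by
  intro x hx
  rcases (show (0 : ℝ) ≤ x from hx).eq_or_lt with rfl | hx
  · rw [← continuousWithinAt_Ioi_iff_Ici]
    exact hβ0.congr' (eventually_mem_nhdsWithin.mono fun ρ hρ => (hβ ρ (ne_of_gt hρ)).symm)
  · have h0 : h x ≠ 0 := by
      have := hh.strictMonoOn self_mem_Ici hx.le hx
      rw [hh.zero] at this
      exact this.ne'
    have h3 : ContinuousAt (fun ρ => ρ * deriv h ρ / h ρ) x :=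
      (continuousAt_id.mul (hh.continuousOn_deriv.continuousAt (Ioi_mem_nhds hx))).div
        (hh.continuousOn.continuousAt (Ici_mem_nhds hx)) h0
    exact (h3.congr ((lt_mem_nhds hx).mono fun ρ hρ =>
      (hβ ρ (ne_of_gt hρ)).symm)).continuousWithinAt

theorem continuousWithinAt_of_tendstoUniformlyOn_compacts {β : ℝ → ℝ} {βa : ℕ → ℝ → ℝ}
    (hc : ∀ a, ContinuousOn (βa a) (Ici 0))
    (hunif : ∀ K : Set ℝ, IsCompact K → K ⊆ Ici 0 → TendstoUniformlyOn βa β atTop K)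
    {x : ℝ} (hx : 0 ≤ x) : ContinuousWithinAt β (Ici 0) x := by
  have h1 := (hunif (Icc 0 (x + 1)) isCompact_Icc Icc_subset_Ici_self).continuousOn
    (Frequently.of_forall fun a => (hc a).mono Icc_subset_Ici_self) x ⟨hx, by linarith⟩
  refine h1.mono_of_mem_nhdsWithin ?_
  filter_upwards [self_mem_nhdsWithin, mem_nhdsWithin_of_mem_nhds (Iio_mem_nhds (lt_add_one x))]
    with y hy hy' using ⟨hy, le_of_lt hy'⟩

end Convergence

theorem ContDiff.contDiff_gradient {φ : E2 → ℝ} (hφ : ContDiff ℝ 2 φ) :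
    ContDiff ℝ 1 (gradient φ) :=
  (InnerProductSpace.toDual ℝ E2).symm.contDiff.comp (hφ.fderiv_right (by norm_num))

theorem continuous_fenchelOp {X : Type*} [TopologicalSpace X] {t : X → ℝ} {p : X → E2}
    {H : X → E2 →L[ℝ] E2} (ht : Continuous t) (hp : Continuous p) (hH : Continuous H) :
    Continuous fun q => fenchelOp (t q) (p q) (H q) := by
  have h1 : Continuous fun A : E2 →L[ℝ] E2 => LinearMap.trace ℝ E2 A.toLinearMap :=
    (LinearMap.trace ℝ E2 ∘ₗ ContinuousLinearMap.coeLM ℝ).continuous_of_finiteDimensional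
  have h2 := h1.comp hH
  simp only [Function.comp_def] at h2
  unfold fenchelOp
  have h3 : Continuous fun q => H q (p q) := hH.clm_apply hp
  fun_prop

theorem fenchelOp_neg (t : ℝ) (p : E2) (H : E2 →L[ℝ] E2) :
    fenchelOp t (-p) (-H) = -fenchelOp t p H := by
  have : ((-H : E2 →L[ℝ] E2) : E2 →ₗ[ℝ] E2) = -H.toLinearMap := rfl
  simp only [fenchelOp, this, map_neg, norm_neg, inner_neg_right, inner_neg_left,
    neg_apply]
  ring

theorem fenchelOp_zero (t : ℝ) (H : E2 →L[ℝ] E2) : fenchelOp t 0 H = 0 := by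
  simp [fenchelOp]

theorem rotFlux_neg (h : ℝ → ℝ) (p : E2) : rotFlux h (-p) = -rotFlux h p := by
  ext i
  fin_cases i <;> simp [rotFlux]

theorem gradient_const_mul_norm_sub_sq (e : ℝ) (x z : E2) :
    gradient (fun y => e * ‖y - x‖ ^ 2) z = (2 * e) • (z - x) := by
  have h1 := ((hasFDerivAt_id z).sub_const x).norm_sq.const_mul e
  have h2 : HasGradientAt (fun y => e * ‖y - x‖ ^ 2) ((2 * e) • (z - x)) z := by
    rw [hasGradientAt_iff_hasFDerivAt]
    refine h1.congr_fderiv ?_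
    ext y
    simp
    ring
  exact h2.gradient

theorem gradient_add_const_mul_norm_sub_sq {φ : E2 → ℝ} (hφ : ContDiff ℝ 2 φ) (e : ℝ) (x : E2) :
    gradient (fun y => φ y + e * ‖y - x‖ ^ 2) = fun z => gradient φ z + (2 * e) • (z - x) := by
  ext1 z
  have hq : ContDiff ℝ 1 fun y : E2 => e * ‖y - x‖ ^ 2 :=
    contDiff_const.mul ((contDiff_id.sub contDiff_const).norm_sq ℝ)
  rw [gradient_add_of_differentiableAt (hφ.differentiable two_ne_zero z)
    (hq.differentiable one_ne_zero z), gradient_const_mul_norm_sub_sq]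

/-- Uniform limits of stream functions of the approximating problems are viscosity
subsolutions of the limit equation. -/
theorem fenchelOp_nonpos_of_isLocalMaxOn {h G : ℕ → ℝ → ℝ} (hh : ∀ k, IsRadialFlux (h k) (G k))
    {Ω : Set E2} (hΩo : IsOpen Ω) {u v : ℕ → E2 → ℝ} (hu : ∀ k, LipOn (u k) Ω)
    (hv : ∀ k, LipOn (v k) Ω)
    (huv : ∀ k, ∀ᵐ z, z ∈ Ω → gradient (v k) z = rotFlux (h k) (gradient (u k) z))
    {w : E2 → ℝ} (hlim : TendstoUniformlyOn v w atTop Ω) {x : E2} (hx : x ∈ Ω) {φ : E2 → ℝ}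
    (hφ : ContDiff ℝ 2 φ) (hmax : IsLocalMaxOn (fun y => w y - φ y) Ω x) {t₀ : ℝ}
    (hp : gradient φ x ≠ 0)
    (hparam : ∀ δ > 0, ∃ s > 0, ∃ ε₀ > 0, ∀ᶠ k in atTop, ∀ ε, 0 < ε → ε ≤ ε₀ → ∀ r,
      |r - ‖gradient φ x‖| ≤ s →
      |regInv (h k) ε r * (deriv (h k) (regInv (h k) ε r) + ε) / r - t₀| ≤ δ) :
    fenchelOp t₀ (gradient φ x) (fderiv ℝ (gradient φ) x) ≤ 0 := by
  by_contra! hpos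
  have hP := hφ.contDiff_gradient
  have hPc := hP.continuous
  have hHc : Continuous (fderiv ℝ (gradient φ)) := hP.continuous_fderiv one_ne_zero
  set P : ℝ → E2 → E2 := fun e z => gradient φ z + (2 * e) • (z - x) with hPdef
  have hPcont : Continuous fun q : ℝ × E2 => P q.1 q.2 := by fun_prop
  have hΨ : Continuous fun q : ℝ × ℝ × E2 => fenchelOp q.1 (P q.2.1 q.2.2)
      (fderiv ℝ (gradient φ) q.2.2 + (2 * q.2.1) • ContinuousLinearMap.id ℝ E2) :=
    continuous_fenchelOp continuous_fst (hPcont.comp continuous_snd) (by fun_prop)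
  have hP0 : P 0 x = gradient φ x := by simp [hPdef]
  have hH0 : fderiv ℝ (gradient φ) x + (0 : ℝ) • ContinuousLinearMap.id ℝ E2
      = fderiv ℝ (gradient φ) x := by
    rw [zero_smul ℝ (ContinuousLinearMap.id ℝ E2), add_zero]
  have ev1 := hΨ.continuousAt (x := (t₀, 0, x)) |>.eventually
    (lt_mem_nhds (a := 0) (by simpa only [hP0, mul_zero, hH0] using hpos))
  obtain ⟨η₁, hη₁, H₁⟩ := Metric.eventually_nhds_iff.1 ev1
  obtain ⟨s', hs', ε₀, hε₀, hk⟩ := hparam (η₁ / 2) (half_pos hη₁)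
  have ev2 : ∀ᶠ q : ℝ × E2 in 𝓝 (0, x), P q.1 q.2 ≠ 0 ∧ |‖P q.1 q.2‖ - ‖gradient φ x‖| < s' := by
    refine ((hPcont.continuousAt (x := (0, x))).eventually_ne (by rwa [hP0])).and ?_
    refine (hPcont.norm.sub continuous_const).abs.continuousAt.eventually
      (gt_mem_nhds (by simpa [hP0] using hs'))
  obtain ⟨η₂, hη₂, H₂⟩ := Metric.eventually_nhds_iff.1 ev2
  rw [IsLocalMaxOn, hΩo.nhdsWithin_eq hx] at hmax
  obtain ⟨η₃, hη₃, H₃⟩ := Metric.eventually_nhds_iff.1 (hmax.and (hΩo.mem_nhds hx))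
  set s := min (min η₁ η₂) η₃ / 2 with hsdef
  have hs : 0 < s := by positivity
  have hs1 : s < η₁ := (half_lt_self (by positivity)).trans_le
    ((min_le_left _ _).trans (min_le_left _ _))
  have hs2 : s < η₂ := (half_lt_self (by positivity)).trans_le
    ((min_le_left _ _).trans (min_le_right _ _))
  have hs3 : s < η₃ := (half_lt_self (by positivity)).trans_le (min_le_right _ _)
  have hd : ∀ z ∈ closedBall x s, dist (s, z) ((0 : ℝ), x) ≤ s := fun z hz => by
    rw [Prod.dist_eq, Real.dist_eq, sub_zero, abs_of_pos hs]
    exact max_le le_rfl hz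
  have hφ' : ContDiff ℝ 2 fun y => φ y + s * ‖y - x‖ ^ 2 :=
    hφ.add (contDiff_const.mul ((contDiff_id.sub contDiff_const).norm_sq ℝ))
  have hgrad := gradient_add_const_mul_norm_sub_sq hφ s x
  have hhess : ∀ z, fderiv ℝ (gradient fun y => φ y + s * ‖y - x‖ ^ 2) z
      = fderiv ℝ (gradient φ) z + (2 * s) • ContinuousLinearMap.id ℝ E2 := fun z => by
    rw [hgrad]
    exact ((hP.differentiable one_ne_zero z).hasFDerivAt.add
      (((hasFDerivAt_id z).sub_const x).const_smul (2 * s))).fderiv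
  set d := s * s ^ 2 / 4 with hddef
  have hd0 : 0 < d := by positivity
  obtain ⟨k, hk, hlk⟩ := (hk.and (Metric.tendstoUniformlyOn_iff.1 hlim d hd0)).exists
  obtain ⟨L, hL⟩ := hu k
  obtain ⟨u', hu', huu'⟩ := hL.extend_real
  obtain ⟨L', hL'⟩ := hv k
  obtain ⟨v', hv', hvv'⟩ := hL'.extend_real
  have hsub : ∀ z ∈ closedBall x s, z ∈ Ω := fun z hz => (H₃ (lt_of_le_of_lt hz hs3)).2
  have key := (hh k).sub_le_of_forall_sphere hu' hv' hs (φ := fun y => φ y + s * ‖y - x‖ ^ 2)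
    (by
      filter_upwards [huv k] with z hz hzb
      have hzΩ := hsub z (ball_subset_closedBall hzb)
      rw [← hvv'.gradient_eq hΩo hzΩ, ← huu'.gradient_eq hΩo hzΩ]
      exact hz hzΩ) hφ' (by
      intro z hz
      rw [hgrad]
      exact (H₂ ((hd z hz).trans_lt hs2)).1) hε₀ (by
      intro ε hε hεε₀ z hz
      rw [hhess, hgrad]
      have h1 := hk ε hε hεε₀ _ (H₂ ((hd z hz).trans_lt hs2)).2.le
      refine (H₁ (y := (_, s, z)) ?_).le
      rw [Prod.dist_eq]
      exact max_lt (h1.trans_lt (half_lt_self hη₁)) ((hd z hz).trans_lt hs1))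
    (c := w x - φ x - s * s ^ 2 + d) (by
      intro z hz
      have hzc := sphere_subset_closedBall hz
      have h1 := abs_lt.1 (hlk z (hsub z hzc))
      have h2 : w z - φ z ≤ w x - φ x := (H₃ (lt_of_le_of_lt hzc hs3)).1
      rw [← hvv' (hsub z hzc), mem_sphere_iff_norm.1 hz]
      linarith [h1.1])
  have h1 := abs_lt.1 (hlk x hx)
  rw [← hvv' hx, sub_self, norm_zero] at key
  have : s * s ^ 2 = 4 * d := by rw [hddef]; ring
  linarith [h1.2]

theorem viscositySol_fenchelOp_of_tendsto {h G : ℕ → ℝ → ℝ}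
    (hh : ∀ k, IsRadialFlux (h k) (G k))
    {Ω : Set E2} (hΩo : IsOpen Ω) {u v : ℕ → E2 → ℝ} (hu : ∀ k, LipOn (u k) Ω)
    (hv : ∀ k, LipOn (v k) Ω)
    (huv : ∀ k, ∀ᵐ z, z ∈ Ω → gradient (v k) z = rotFlux (h k) (gradient (u k) z))
    {w : E2 → ℝ} (hlim : TendstoUniformlyOn v w atTop Ω) {τ : ℝ → ℝ}
    (hparam : ∀ r₀ > 0, ∀ δ > 0, ∃ s > 0, ∃ ε₀ > 0, ∀ᶠ k in atTop, ∀ ε, 0 < ε → ε ≤ ε₀ → ∀ r,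
      |r - r₀| ≤ s →
      |regInv (h k) ε r * (deriv (h k) (regInv (h k) ε r) + ε) / r - τ r₀| ≤ δ) :
    ViscositySol Ω (fun p H => fenchelOp (τ ‖p‖) p H) w := by
  refine ⟨hlim.continuousOn (Frequently.of_forall fun k => ?_), ?_, ?_⟩
  · obtain ⟨L, hL⟩ := hv k
    exact hL.continuousOn
  · intro x hx φ hφ hmax
    by_cases hp : gradient φ x = 0
    · simp only [hp, fenchelOp_zero, le_refl]
    · exact fenchelOp_nonpos_of_isLocalMaxOn hh hΩo hu hv huv hlim hx hφ hmax hp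
        (hparam _ (norm_pos_iff.2 hp))
  · intro x hx φ hφ hmin
    by_cases hp : gradient φ x = 0
    · simp only [hp, fenchelOp_zero, le_refl]
    · have hneg : gradient (fun y => -φ y) = fun z => -gradient φ z :=
        funext (gradient_neg_apply φ)
      have hp' : gradient (fun y => -φ y) x ≠ 0 := by rw [hneg]; exact neg_ne_zero.2 hp
      have hlip : ∀ {a : E2 → ℝ}, LipOn a Ω → LipOn (fun z => -a z) Ω :=
        fun ⟨L, hL⟩ => ⟨L, hL.neg⟩
      have := fenchelOp_nonpos_of_isLocalMaxOn hh hΩo (u := fun k z => -u k z)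
        (v := fun k z => -v k z) (w := fun z => -w z) (fun k => hlip (hu k))
        (fun k => hlip (hv k)) (fun k => by
          filter_upwards [huv k] with z hz hzΩ
          rw [gradient_neg_apply, gradient_neg_apply, rotFlux_neg, hz hzΩ])
        (by
          rw [Metric.tendstoUniformlyOn_iff] at hlim ⊢
          simpa only [dist_neg_neg] using hlim) hx hφ.neg
        (by
          refine hmin.neg.congr (Eventually.of_forall fun z => ?_) hx
          simp only
          ring) hp' (hparam _ (norm_pos_iff.2 hp'))
      rw [hneg] at this
      have hf : fderiv ℝ (fun z => -gradient φ z) x = -fderiv ℝ (gradient φ) x :=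
        fderiv_fun_neg
      rw [hf, fenchelOp_neg, norm_neg] at this
      linarith

theorem exists_tendstoUniformlyOn_subseq_of_lipschitzOnWith {Ω : Set E2}
    (hΩb : Bornology.IsBounded Ω) {C : NNReal} {v : ℕ → E2 → ℝ}
    (hv : ∀ k, LipschitzOnWith C (v k) Ω) {M : ℝ} (hM : ∀ k, ∀ x ∈ Ω, |v k x| ≤ M) :
    ∃ σ : ℕ → ℕ, StrictMono σ ∧ ∃ w : E2 → ℝ,
      TendstoUniformlyOn (fun k => v (σ k)) w atTop Ω := by
  have hK : IsCompact (closure Ω) := hΩb.isCompact_closure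
  have : CompactSpace ↥(closure Ω) := isCompact_iff_compactSpace.1 hK
  choose e he hve using fun k => (hv k).extend_real
  have hM' : ∀ k, ∀ x ∈ closure Ω, e k x ∈ closedBall (0 : ℝ) M := fun k =>
    closure_minimal (t := e k ⁻¹' closedBall 0 M)
      (fun y hy => by simpa [← hve k hy] using hM k y hy)
      (isClosed_closedBall.preimage (he k).continuous)
  let F : ℕ → BoundedContinuousFunction ↥(closure Ω) ℝ := fun k =>
    BoundedContinuousFunction.mkOfCompact
      ⟨fun x => e k x, (he k).continuous.comp continuous_subtype_val⟩
  have hcomp := BoundedContinuousFunction.arzela_ascoli (closedBall (0 : ℝ) M)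
    (isCompact_closedBall 0 M) (range F) (by
      rintro _ x ⟨k, rfl⟩
      exact hM' k x x.2) (by
      refine (LipschitzWith.uniformEquicontinuous _ C ?_).equicontinuous
      rintro ⟨_, k, rfl⟩
      exact fun x y => he k x y)
  obtain ⟨w, -, σ, hσ, hlim⟩ := hcomp.tendsto_subseq fun k => subset_closure (mem_range_self k)
  refine ⟨σ, hσ, fun x => if hx : x ∈ closure Ω then w ⟨x, hx⟩ else 0, ?_⟩
  rw [Metric.tendstoUniformlyOn_iff]
  intro ε hε
  filter_upwards [Metric.tendstoUniformly_iff.1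
    (BoundedContinuousFunction.tendsto_iff_tendstoUniformly.1 hlim) ε hε] with k hk x hx
  have := hk ⟨x, subset_closure hx⟩
  rw [dif_pos (subset_closure hx), hve _ hx]
  exact this

theorem abs_le_of_setIntegral_eq_zero {Ω : Set E2} (hΩo : IsOpen Ω)
    (hΩb : Bornology.IsBounded Ω) {C : NNReal} {v : E2 → ℝ} (hv : LipschitzOnWith C v Ω)
    (h0 : ∫ z in Ω, v z = 0) {x : E2} (hx : x ∈ Ω) : |v x| ≤ C * diam Ω := by
  have hμ : volume Ω ≠ ⊤ := hΩb.measure_lt_top.ne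
  have hpos : 0 < volume.real Ω :=
    ENNReal.toReal_pos (hΩo.measure_pos volume ⟨x, hx⟩).ne' hμ
  have hdist : ∀ z ∈ Ω, |v x - v z| ≤ C * diam Ω := fun z hz =>
    (hv.dist_le_mul x hx z hz).trans
      (mul_le_mul_of_nonneg_left (dist_le_diam_of_mem hΩb hx hz) C.2)
  have hint : IntegrableOn v Ω := by
    refine IntegrableOn.of_bound hΩb.measure_lt_top
      (hv.continuousOn.aestronglyMeasurable hΩo.measurableSet) (|v x| + C * diam Ω) ?_
    refine (ae_restrict_iff' hΩo.measurableSet).2 (Eventually.of_forall fun z hz => ?_)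
    rw [Real.norm_eq_abs]
    have := abs_sub (v x) (v x - v z)
    rw [sub_sub_cancel] at this
    exact this.trans (add_le_add_right (hdist z hz) _)
  have h1 : ∫ z in Ω, (v x - v z) = volume.real Ω * v x := by
    have hc : IntegrableOn (fun _ => v x) Ω := integrableOn_const hμ
    rw [integral_sub hc hint, h0, sub_zero, setIntegral_const, smul_eq_mul]
  have h2 : ‖∫ z in Ω, (v x - v z)‖ ≤ C * diam Ω * volume.real Ω :=
    norm_setIntegral_le_of_norm_le_const hΩb.measure_lt_top hdist
  rw [h1, norm_mul, Real.norm_of_nonneg hpos.le, mul_comm] at h2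
  exact le_of_mul_le_mul_right h2 hpos

theorem dtop_le_of_tendstoUniformlyOn {f : ℝ → ℝ} {fa : ℕ → ℝ → ℝ}
    (hfa : ∀ a, StrictConvexOn ℝ (Ici 0) (fa a)) (h1a : ∀ a, ContDiffOn ℝ 1 (fa a) (Ici 0))
    (hunif : TendstoUniformlyOn (fun a ρ => fa a ρ) f atTop (Ici 0)) {q : ℝ} (hq : 0 ≤ q) :
    ∀ᶠ a in atTop, dtop (fa a) q ≤ f (q + 1) - f q + 2 := by
  filter_upwards [Metric.tendstoUniformlyOn_iff.1 hunif 1 one_pos] with a ha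
  have e1 := dtop_mul_lt_sub (hfa a) (h1a a) hq (lt_add_one q)
  have e3 := abs_lt.1 (ha q hq)
  have e4 := abs_lt.1 (ha (q + 1) (show (0 : ℝ) ≤ q + 1 by linarith))
  linarith

/-- In the approximation scheme, if moreover `αₐ → α` uniformly on compact
subsets of `[0,∞)`, then the stream functions `vₐ` subconverge uniformly on `Ω` to a
viscosity solution `v` of `−[1 − α(g'(‖∇v‖))]·Δ∞v − ‖∇v‖²·α(g'(‖∇v‖))·Δv = 0`, where `g`
is the Fenchel conjugate of `f` and `g'` its derivative. -/
theorem stream_functions_subconverge_to_viscositySolution_fenchel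
    (f : ℝ → ℝ) (hf : StdF f)
    (Ω : Set E2) (hΩo : IsOpen Ω) (hΩb : Bornology.IsBounded Ω)
    (hsc : SimplyConnectedSpace ↥Ω)
    (ψ : E2 → ℝ) (hψ : ContinuousOn ψ (frontier Ω))
    (Q : ℝ) (hQ : 0 < Q) (hbsc : BSC Ω ψ Q)
    (hlim0 : ∃ ℓ : ℝ, Tendsto (fun ρ => ρ * deriv (dtop f) ρ / dtop f ρ)
      (nhdsWithin 0 (Set.Ioi 0)) (nhds ℓ))
    (αinf : ℝ) (hαinf : 0 < αinf)
    (hliminf : Tendsto (fun ρ => ρ * deriv (dtop f) ρ / dtop f ρ) atTop (nhds αinf))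
    (α : ℝ → ℝ)
    (hα : ∀ ρ : ℝ, α ρ = if ρ = 0 then 0 else ρ * deriv (dtop f) ρ / dtop f ρ)
    (fa : ℕ → ℝ → ℝ)
    (hconv : ∀ a, StrictConvexOn ℝ (Set.Ici 0) (fa a))
    (hC1 : ∀ a, ContDiffOn ℝ 1 (fa a) (Set.Ici 0))
    (hC2 : ∀ a, ContDiffOn ℝ 2 (fa a) (Set.Ioi 0))
    (h0 : ∀ a, dtop (fa a) 0 = 0)
    (hmono : ∀ a, StrictMonoOn (dtop (fa a)) (Set.Ici 0))
    (hbij : ∀ a, Set.BijOn (dtop (fa a)) (Set.Ici 0) (Set.Ici 0))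
    (gpa : ℕ → ℝ → ℝ)
    (hinv : ∀ a, Set.InvOn (gpa a) (dtop (fa a)) (Set.Ici 0) (Set.Ici 0))
    (hunif : TendstoUniformlyOn (fun a ρ => fa a ρ) f atTop (Set.Ici 0))
    (αa : ℕ → ℝ → ℝ)
    (hαa : ∀ a, ∀ ρ : ℝ, ρ ≠ 0 →
      αa a ρ = ρ * deriv (dtop (fa a)) ρ / dtop (fa a) ρ)
    (hαa0 : ∀ a, 0 < αa a 0 ∧
      Tendsto (fun ρ => ρ * deriv (dtop (fa a)) ρ / dtop (fa a) ρ)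
        (nhdsWithin 0 (Set.Ioi 0)) (nhds (αa a 0)))
    (ua : ℕ → E2 → ℝ) (hua : ∀ a, SolvesP (fa a) Ω ψ (ua a))
    (va : ℕ → E2 → ℝ) (hva : ∀ a, IsStreamFn (dtop (fa a)) Ω (ua a) (va a))
    (hαunif : ∀ K : Set ℝ, IsCompact K → K ⊆ Set.Ici 0 →
      TendstoUniformlyOn (fun a ρ => αa a ρ) α atTop K) :
    ∃ σ : ℕ → ℕ, StrictMono σ ∧ ∃ v : E2 → ℝ,
      TendstoUniformlyOn (fun k => va (σ k)) v atTop Ω ∧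
      ViscositySol Ω
        (fun p H => -(1 - α (dtop (fenchel f) ‖p‖)) * ⟪H p, p⟫
          - ‖p‖ ^ 2 * α (dtop (fenchel f) ‖p‖) * LinearMap.trace ℝ E2 H.toLinearMap) v := by
  obtain ⟨hfc, hf1, -⟩ := hf
  have hrad : ∀ a, RadialLagrangian (fa a) := fun a => ⟨hconv a, hC1 a, h0 a⟩
  have hflux : ∀ a, IsRadialFlux (dtop (fa a)) (gpa a) := fun a =>
    isRadialFlux_dtop (hC1 a) (hC2 a) (h0 a) (hmono a) (hbij a) (hinv a)
  have hlim : ∀ ρ, 0 ≤ ρ → Tendsto (fun a => fa a ρ) atTop (𝓝 (f ρ)) :=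
    fun ρ hρ => hunif.tendsto_at hρ
  have hub := exists_lt_dtop_of_tendstoUniformlyOn hfc hf1 hconv hC1
    (fun a => (hbij a).surjOn) hunif
  have hαc : ∀ x, 0 ≤ x → ContinuousWithinAt α (Ici 0) x := fun x hx =>
    continuousWithinAt_of_tendstoUniformlyOn_compacts
      (fun a => (hflux a).continuousOn_of_eq_elasticity (hαa a) (hαa0 a).2) hαunif hx
  have hparam : ∀ r₀ > 0, ∀ δ > 0, ∃ s > 0, ∃ ε₀ > 0, ∀ᶠ a in atTop, ∀ ε, 0 < ε → ε ≤ ε₀ →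
      ∀ r, |r - r₀| ≤ s → |regInv (dtop (fa a)) ε r
        * (deriv (dtop (fa a)) (regInv (dtop (fa a)) ε r) + ε) / r
        - α (dtop (fenchel f) r₀)| ≤ δ := fun r₀ hr₀ δ hδ => by
    have h := IsFenchelArg.dtop_fenchel hr₀ hfc hf1 hub
    exact h.eventually_abs_regInv_param_sub_le hr₀ hfc hf1 hconv hC1 hflux hlim
      (hαc _ h.nonneg) hαa hαunif hδ
  obtain ⟨a₀, ha₀⟩ := eventually_atTop.1 (dtop_le_of_tendstoUniformlyOn hconv hC1 hunif hQ.le)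
  have hpre : IsPreconnected Ω := isPreconnected_iff_preconnectedSpace.2 inferInstance
  have hlip : ∀ k, LipschitzOnWith (f (Q + 1) - f Q + 2).toNNReal (va (a₀ + k)) Ω := fun k =>
    LipschitzOnWith.of_dist_le_mul fun x hx y hy => by
      rw [Real.dist_eq, dist_eq_norm]
      refine ((hva _).abs_sub_le_of_bsc (hrad _) hΩo hΩb hpre (hua _) hQ.le hbsc hx hy).trans ?_
      exact mul_le_mul_of_nonneg_right
        ((ha₀ _ (Nat.le_add_right a₀ k)).trans (Real.le_coe_toNNReal _)) (norm_nonneg _)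
  obtain ⟨σ, hσ, v, hv⟩ := exists_tendstoUniformlyOn_subseq_of_lipschitzOnWith hΩb hlip
    fun k x hx => abs_le_of_setIntegral_eq_zero hΩo hΩb (hlip k) (hva _).2.1 hx
  have hσ' : StrictMono fun k => a₀ + σ k := fun i j hij => Nat.add_lt_add_left (hσ hij) a₀
  refine ⟨fun k => a₀ + σ k, hσ', v, hv, ?_⟩
  refine viscositySol_fenchelOp_of_tendsto (fun k => hflux (a₀ + σ k)) hΩo
    (u := fun k => ua (a₀ + σ k)) (fun k => ?_) (fun k => (hva _).1)
    (fun k => (hva _).ae_gradient_eq hΩo) hv (τ := fun r => α (dtop (fenchel f) r))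
    fun r₀ hr₀ δ hδ => ?_
  · obtain ⟨L, hL⟩ := (hua (a₀ + σ k)).1
    exact ⟨L, hL.mono subset_closure⟩
  · obtain ⟨s, hs, ε₀, hε₀, hev⟩ := hparam r₀ hr₀ δ hδ
    exact ⟨s, hs, ε₀, hε₀, hσ'.tendsto_atTop.eventually hev⟩
end
end

section
/- Define u : ℝ² → ℝ by u(x,y) = 1 − √((1−x²−y²)/2 + (1/2)·√((1−x²−y²)² + 4y²)) for x ≥ 0 and u(x,y) = −1 + √((1−x²−y²)/2 + (1/2)·√((1−x²−y²)² + 4y²)) for x < 0. Then for every 0 < R < 1: u is continuously differentiable on the open ball B(0,R) with Lipschitz-continuous gradient there (u is of class C^{1,1}); the set {z ∈ B(0,R) : ∇u(z) = 0} has Lebesgue measure zero; and u is a weak solution in B(0,R) of div(√(1+‖∇u‖²)·∇u/‖∇u‖) = 0, i.e. ∫_{B(0,R)} √(1+‖∇u(z)‖²)·⟨∇u(z)/‖∇u(z)‖, ∇φ(z)⟩ dz = 0 for every smooth φ with compact support contained in B(0,R), the integrand being taken equal to 0 where ∇u(z) = 0. -/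
open Set MeasureTheory Metric Filter
open scoped RealInnerProductSpace Topology Classical

noncomputable section

/-- `u` is a weak solution of `div(f'(‖∇u‖)∇u/‖∇u‖) = 0` in `Ω`: the integral identity holds
against every smooth test function compactly supported in `Ω`, the integrand being `0` at
critical points of `u`. -/
def WeakSol (f' : ℝ → ℝ) (Ω : Set E2) (u : E2 → ℝ) : Prop :=
  ∀ φ : E2 → ℝ, ContDiff ℝ (⊤ : ℕ∞) φ → HasCompactSupport φ → tsupport φ ⊆ Ω →
    (∫ z in Ω, (if gradient u z = 0 then 0 else
      f' ‖gradient u z‖ * ⟪(‖gradient u z‖)⁻¹ • gradient u z, gradient φ z⟫)) = 0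

/-- The explicit function of Statement 15, written in coordinates `x = z 0`, `y = z 1`. -/
def uEx (z : E2) : ℝ :=
  if 0 ≤ z 0 then
    1 - Real.sqrt ((1 - (z 0) ^ 2 - (z 1) ^ 2) / 2
      + (1 / 2) * Real.sqrt ((1 - (z 0) ^ 2 - (z 1) ^ 2) ^ 2 + 4 * (z 1) ^ 2))
  else
    -1 + Real.sqrt ((1 - (z 0) ^ 2 - (z 1) ^ 2) / 2
      + (1 / 2) * Real.sqrt ((1 - (z 0) ^ 2 - (z 1) ^ 2) ^ 2 + 4 * (z 1) ^ 2))

lemma ContinuousOn.integrable_mul_of_tsupport_subset {E : Type*} [TopologicalSpace E]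
    [MeasurableSpace E] [OpensMeasurableSpace E] {μ : Measure E} [IsFiniteMeasureOnCompacts μ]
    {f g : E → ℝ} {U : Set E} (hf : ContinuousOn f U) (hU : IsOpen U) (hg : Continuous g)
    (hgc : HasCompactSupport g) (hgU : tsupport g ⊆ U) :
    Integrable (fun z => f z * g z) μ := by
  have hc : Continuous (fun z => f z * g z) := continuous_of_tsupport fun z hz =>
    (hf.continuousAt (hU.mem_nhds (hgU (tsupport_mul_subset_right hz)))).mul hg.continuousAt
  exact hc.integrable_of_hasCompactSupport hgc.mul_left

section LocallySmooth

variable {E : Type*} [NormedAddCommGroup E] [NormedSpace ℝ E]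

/-- A function of the form `rot ∇w` is divergence free in the sense of distributions. -/
lemma integral_fderiv_mul_fderiv_sub_eq_zero [FiniteDimensional ℝ E] [MeasurableSpace E]
    [BorelSpace E] {μ : Measure E} [μ.IsAddHaarMeasure] {w φ : E → ℝ} {U : Set E} (hU : IsOpen U)
    (hw : ContDiffOn ℝ 1 w U) (hφ : ContDiff ℝ 2 φ) (hφc : HasCompactSupport φ)
    (hφU : tsupport φ ⊆ U) (a b : E) :
    ∫ z, (fderiv ℝ w z a * fderiv ℝ φ z b - fderiv ℝ w z b * fderiv ℝ φ z a) ∂μ = 0 := by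
  have hφ' : ContDiff ℝ 1 (fderiv ℝ φ) := hφ.fderiv_right (by norm_num)
  have hd : ∀ c, ContDiff ℝ 1 (fun z => fderiv ℝ φ z c) := fun c => hφ'.clm_apply contDiff_const
  have hs : ∀ c, tsupport (fun z => fderiv ℝ φ z c) ⊆ tsupport φ := fun c =>
    tsupport_fderiv_apply_subset ℝ c
  have hcs : ∀ c, HasCompactSupport (fun z => fderiv ℝ φ z c) := fun c =>
    hφc.fderiv_apply ℝ c
  have hdd : ∀ c d, Continuous (fun z => fderiv ℝ (fun y => fderiv ℝ φ y c) z d) := fun c d =>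
    ((hd c).continuous_fderiv (by norm_num)).clm_apply continuous_const
  have hw' : ContinuousOn (fderiv ℝ w) U := hw.continuousOn_fderiv_of_isOpen hU le_rfl
  have hint1 : ∀ c d, Integrable (fun z => fderiv ℝ w z c * fderiv ℝ φ z d) μ := fun c d =>
    ContinuousOn.integrable_mul_of_tsupport_subset (hw'.clm_apply continuousOn_const) hU
      (hd d).continuous (hcs d) ((hs d).trans hφU)
  have hparts : ∀ c d, ∫ z, w z * fderiv ℝ (fun y => fderiv ℝ φ y c) z d ∂μ
      = - ∫ z, fderiv ℝ w z d * fderiv ℝ φ z c ∂μ := fun c d =>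
    integral_mul_fderiv_eq_neg_fderiv_mul_of_integrable (hint1 d c)
      (hw.continuousOn.integrable_mul_of_tsupport_subset hU (hdd c d) ((hcs c).fderiv_apply ℝ d)
        ((tsupport_fderiv_apply_subset ℝ d).trans ((hs c).trans hφU)))
      (hw.continuousOn.integrable_mul_of_tsupport_subset hU (hd c).continuous (hcs c)
        ((hs c).trans hφU))
      (fun z hz => ((hw.contDiffAt (hU.mem_nhds (hφU (hs c hz)))).differentiableAt (by norm_num)))
      (fun z _ => (hd c).differentiable (by norm_num) z)
  have hsymm : ∀ z, fderiv ℝ (fun y => fderiv ℝ φ y b) z a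
      = fderiv ℝ (fun y => fderiv ℝ φ y a) z b := fun z => by
    have h2 : IsSymmSndFDerivAt ℝ φ z := hφ.contDiffAt.isSymmSndFDerivAt (by simp)
    have hz := hφ'.differentiable (by norm_num) z
    rw [fderiv_clm_apply hz (differentiableAt_const _),
      fderiv_clm_apply hz (differentiableAt_const _)]
    simpa using h2.eq a b
  rw [integral_sub (hint1 a b) (hint1 b a)]
  have h1 := hparts b a
  have h2 := hparts a b
  simp only [hsymm] at h1
  linarith

lemma ContDiffOn.exists_lipschitzOnWith_of_convex_isCompact {F : Type*} [NormedAddCommGroup F]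
    [NormedSpace ℝ F] {f : E → F} {U K : Set E} (hf : ContDiffOn ℝ 1 f U) (hU : IsOpen U)
    (hK : IsCompact K) (hKc : Convex ℝ K) (hKU : K ⊆ U) : ∃ L, LipschitzOnWith L f K := by
  obtain ⟨C, hC⟩ := hK.exists_bound_of_continuousOn
    ((hf.continuousOn_fderiv_of_isOpen hU le_rfl).mono hKU)
  refine ⟨C.toNNReal, hKc.lipschitzOnWith_of_nnnorm_fderiv_le
    (fun z hz => (hf.contDiffAt (hU.mem_nhds (hKU hz))).differentiableAt (by norm_num))
    fun z hz => ?_⟩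
  rw [← NNReal.coe_le_coe, coe_nnnorm]
  exact (hC z hz).trans (Real.le_coe_toNNReal C)

end LocallySmooth

lemma LipschitzOnWith.smul_of_norm_le {α F : Type*} [PseudoMetricSpace α] [NormedAddCommGroup F]
    [NormedSpace ℝ F] {f : α → ℝ} {g : α → F} {s : Set α} {Lf Lg A B : NNReal}
    (hf : LipschitzOnWith Lf f s) (hg : LipschitzOnWith Lg g s) (hA : ∀ z ∈ s, ‖f z‖ ≤ A)
    (hB : ∀ z ∈ s, ‖g z‖ ≤ B) :
    LipschitzOnWith (A * Lg + Lf * B) (fun z => f z • g z) s := by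
  refine LipschitzOnWith.of_dist_le_mul fun x hx y hy => ?_
  have h1 := hf.dist_le_mul x hx y hy
  have h2 := hg.dist_le_mul x hx y hy
  rw [dist_eq_norm] at h1 h2 ⊢
  have h3 : f x • g x - f y • g y = f x • (g x - g y) + (f x - f y) • g y := by
    module
  rw [h3]
  push_cast
  calc _ ≤ ‖f x‖ * ‖g x - g y‖ + ‖f x - f y‖ * ‖g y‖ := by
        simpa only [norm_smul] using norm_add_le (f x • (g x - g y)) ((f x - f y) • g y)
    _ ≤ A * (Lg * dist x y) + (Lf * dist x y) * B := by
        gcongr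
        exacts [hA x hx, hB y hy]
    _ = _ := by ring

/-- `|cos² ζ|` where `z = sin ζ`. -/
def dEx (z : E2) : ℝ := √((1 - (z 0) ^ 2 - (z 1) ^ 2) ^ 2 + 4 * (z 1) ^ 2)

/-- `cos (re ζ)` where `z = sin ζ`. -/
def vEx (z : E2) : ℝ := √((1 - (z 0) ^ 2 - (z 1) ^ 2) / 2 + (1 / 2) * dEx z)

/-- `sinh (im ζ)` where `z = sin ζ`. -/
def wEx (z : E2) : ℝ := z 1 / vEx z

/-- The smooth vector field with `∇ uEx = |x| • hEx`. -/
def hEx (z : E2) : E2 :=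
  !₂[vEx z / dEx z, -(vEx z * (z 0) * (z 1)) / (dEx z * (vEx z ^ 2 + (z 1) ^ 2))]

lemma mem_ball_zero_one_iff {z : E2} : z ∈ ball (0 : E2) 1 ↔ (z 0) ^ 2 + (z 1) ^ 2 < 1 := by
  rw [mem_ball_zero_iff, ← sq_lt_one_iff₀ (norm_nonneg z), EuclideanSpace.real_norm_sq_eq,
    Fin.sum_univ_two]

lemma toDual_smul_hEx (z : E2) (c : ℝ) :
    InnerProductSpace.toDual ℝ E2 (c • hEx z)
      = (c * (vEx z / dEx z)) • EuclideanSpace.proj (𝕜 := ℝ) (0 : Fin 2)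
        + (c * (-(vEx z * (z 0) * (z 1)) / (dEx z * (vEx z ^ 2 + (z 1) ^ 2)))) •
          EuclideanSpace.proj (𝕜 := ℝ) (1 : Fin 2) := by
  ext t
  simp [hEx, PiLp.inner_apply, Fin.sum_univ_two]
  ring

lemma one_sub_sq_pos {z : E2} (hz : z ∈ ball (0 : E2) 1) : 0 < 1 - (z 0) ^ 2 - (z 1) ^ 2 := by
  linarith [mem_ball_zero_one_iff.1 hz]

lemma dEx_radicand_pos {z : E2} (hz : z ∈ ball (0 : E2) 1) :
    0 < (1 - (z 0) ^ 2 - (z 1) ^ 2) ^ 2 + 4 * (z 1) ^ 2 := by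
  have := one_sub_sq_pos hz
  positivity

lemma dEx_pos {z : E2} (hz : z ∈ ball (0 : E2) 1) :
    0 < dEx z := Real.sqrt_pos.2 (dEx_radicand_pos hz)

lemma dEx_sq {z : E2} (hz : z ∈ ball (0 : E2) 1) :
    dEx z ^ 2 = (1 - (z 0) ^ 2 - (z 1) ^ 2) ^ 2 + 4 * (z 1) ^ 2 :=
  Real.sq_sqrt (dEx_radicand_pos hz).le

lemma vEx_radicand_pos {z : E2} (hz : z ∈ ball (0 : E2) 1) :
    0 < (1 - (z 0) ^ 2 - (z 1) ^ 2) / 2 + (1 / 2) * dEx z := by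
  have := one_sub_sq_pos hz
  have := dEx_pos hz
  positivity

lemma vEx_pos {z : E2} (hz : z ∈ ball (0 : E2) 1) :
    0 < vEx z := Real.sqrt_pos.2 (vEx_radicand_pos hz)

lemma two_mul_vEx_sq {z : E2} (hz : z ∈ ball (0 : E2) 1) :
    2 * vEx z ^ 2 = 1 - (z 0) ^ 2 - (z 1) ^ 2 + dEx z := by
  rw [vEx, Real.sq_sqrt (vEx_radicand_pos hz).le]
  ring

lemma dEx_mul_vEx_sq {z : E2} (hz : z ∈ ball (0 : E2) 1) :
    dEx z * vEx z ^ 2 = vEx z ^ 4 + (z 1) ^ 2 := by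
  have h1 := dEx_sq hz
  have h2 : dEx z = 2 * vEx z ^ 2 - (1 - (z 0) ^ 2 - (z 1) ^ 2) := by linarith [two_mul_vEx_sq hz]
  rw [h2] at h1 ⊢
  linear_combination h1 / 4

/-- The confocal hyperbolas `x² / sin² τ - y² / cos² τ = 1`. -/
lemma sq_mul_vEx_sq {z : E2} (hz : z ∈ ball (0 : E2) 1) :
    (z 0) ^ 2 * vEx z ^ 2 = (1 - vEx z ^ 2) * (vEx z ^ 2 + (z 1) ^ 2) := by
  have h1 := dEx_mul_vEx_sq hz
  have h2 := two_mul_vEx_sq hz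
  linear_combination h1 + vEx z ^ 2 * h2

lemma contDiffAt_dEx {z : E2} (hz : z ∈ ball (0 : E2) 1)
    {n : WithTop ℕ∞} : ContDiffAt ℝ n dEx z := by
  refine ContDiffAt.sqrt ?_ (dEx_radicand_pos hz).ne'
  fun_prop

lemma contDiffAt_vEx {z : E2} (hz : z ∈ ball (0 : E2) 1)
    {n : WithTop ℕ∞} : ContDiffAt ℝ n vEx z := by
  refine ContDiffAt.sqrt ?_ (vEx_radicand_pos hz).ne'
  have := contDiffAt_dEx hz (n := n)
  fun_prop

lemma contDiffAt_hEx {z : E2} (hz : z ∈ ball (0 : E2) 1)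
    {n : WithTop ℕ∞} : ContDiffAt ℝ n hEx z := by
  have hd := contDiffAt_dEx hz (n := n)
  have hv := contDiffAt_vEx hz (n := n)
  have hd0 := dEx_pos hz
  have hv0 := vEx_pos hz
  rw [contDiffAt_euclidean]
  intro i
  fin_cases i
  · exact hv.div hd hd0.ne'
  · exact ContDiffAt.div (by fun_prop) (by fun_prop) (by positivity)

lemma hasFDerivAt_vEx {z : E2} (hz : z ∈ ball (0 : E2) 1) :
    HasFDerivAt vEx (-((z 0) * vEx z / dEx z) • EuclideanSpace.proj (𝕜 := ℝ) (0 : Fin 2)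
      + ((z 1) * (1 - vEx z ^ 2) / (vEx z * dEx z)) • EuclideanSpace.proj (𝕜 := ℝ) (1 : Fin 2))
      z := by
  have hd0 := dEx_pos hz
  have hv0 := vEx_pos hz
  have h0 : HasFDerivAt (fun z : E2 => z 0)
      (EuclideanSpace.proj (0 : Fin 2) : E2 →L[ℝ] ℝ) z :=
    (EuclideanSpace.proj (0 : Fin 2) : E2 →L[ℝ] ℝ).hasFDerivAt
  have h1 : HasFDerivAt (fun z : E2 => z 1)
      (EuclideanSpace.proj (1 : Fin 2) : E2 →L[ℝ] ℝ) z :=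
    (EuclideanSpace.proj (1 : Fin 2) : E2 →L[ℝ] ℝ).hasFDerivAt
  have hr := ((h0.pow 2).const_sub 1).sub (h1.pow 2)
  have hd := ((hr.pow 2).add ((h1.pow 2).const_mul 4)).sqrt (dEx_radicand_pos hz).ne'
  have hv := ((hr.mul_const (2⁻¹)).add (hd.const_mul (1 / 2))).sqrt (vEx_radicand_pos hz).ne'
  have e := two_mul_vEx_sq hz
  refine hv.congr_fderiv ?_
  change (1 / (2 * vEx z)) • (_ + (1 / 2 : ℝ) • (1 / (2 * dEx z)) • _) = _
  ext t
  simp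
  field_simp
  linear_combination (2 * ((z 0) * t 0 + (z 1) * t 1)) * e

lemma contDiffAt_wEx {z : E2} (hz : z ∈ ball (0 : E2) 1)
    {n : WithTop ℕ∞} : ContDiffAt ℝ n wEx z := by
  have hv := contDiffAt_vEx hz (n := n)
  exact ContDiffAt.div (by fun_prop) hv (vEx_pos hz).ne'

lemma hasFDerivAt_wEx {z : E2} (hz : z ∈ ball (0 : E2) 1) :
    HasFDerivAt wEx (((z 0) * (z 1) / (vEx z * dEx z)) • EuclideanSpace.proj (𝕜 := ℝ) (0 : Fin 2)
      + ((vEx z ^ 2 + (z 1) ^ 2) / (vEx z * dEx z)) • EuclideanSpace.proj (𝕜 := ℝ) (1 : Fin 2))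
      z := by
  have hd0 := dEx_pos hz
  have hv0 := vEx_pos hz
  have h1 : HasFDerivAt (fun z : E2 => z 1)
      (EuclideanSpace.proj (1 : Fin 2) : E2 →L[ℝ] ℝ) z :=
    (EuclideanSpace.proj (1 : Fin 2) : E2 →L[ℝ] ℝ).hasFDerivAt
  have hw := h1.mul ((hasDerivAt_inv hv0.ne').comp_hasFDerivAt z (hasFDerivAt_vEx hz))
  have e := dEx_mul_vEx_sq hz
  refine hw.congr_fderiv ?_
  ext t
  simp
  field_simp
  linear_combination ((t 1)) * e

lemma norm_sq_hEx {z : E2} (hz : z ∈ ball (0 : E2) 1) :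
    ‖hEx z‖ ^ 2 = vEx z ^ 2 / (dEx z * (vEx z ^ 2 + (z 1) ^ 2)) := by
  have hd0 := dEx_pos hz
  have hv0 := vEx_pos hz
  have e1 := dEx_mul_vEx_sq hz
  have e2 := sq_mul_vEx_sq hz
  have hq : 0 < vEx z ^ 2 + (z 1) ^ 2 := by positivity
  rw [EuclideanSpace.real_norm_sq_eq, Fin.sum_univ_two]
  simp only [hEx, Matrix.cons_val_zero, Matrix.cons_val_one]
  field_simp
  refine mul_left_cancel₀ (pow_ne_zero 2 hv0.ne') ?_
  linear_combination (z 1) ^ 2 * e2 - (vEx z ^ 2 + (z 1) ^ 2) * e1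

lemma hEx_ne_zero {z : E2} (hz : z ∈ ball (0 : E2) 1) : hEx z ≠ 0 := fun h => by
  have h0 : hEx z 0 = 0 := by rw [h]; rfl
  exact (div_pos (vEx_pos hz) (dEx_pos hz)).ne' h0

lemma sqrt_one_add_sq_mul_norm_sq_hEx {z : E2} (hz : z ∈ ball (0 : E2) 1) :
    √(1 + (|z 0| * ‖hEx z‖) ^ 2) = (vEx z ^ 2 + (z 1) ^ 2) / vEx z ^ 2 * ‖hEx z‖ := by
  have hd0 := dEx_pos hz
  have hv0 := vEx_pos hz
  have e1 := dEx_mul_vEx_sq hz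
  have e2 := sq_mul_vEx_sq hz
  have hq : 0 < vEx z ^ 2 + (z 1) ^ 2 := by positivity
  rw [Real.sqrt_eq_iff_eq_sq (by positivity) (by positivity), mul_pow, mul_pow, sq_abs,
    norm_sq_hEx hz]
  field_simp
  linear_combination vEx z ^ 2 * e2 + (vEx z ^ 2 + (z 1) ^ 2) * e1

lemma one_sub_vEx_mem_Icc {z : E2} (hz : z ∈ ball (0 : E2) 1) : 1 - vEx z ∈ Icc 0 ((z 0) ^ 2) := by
  have hv0 := vEx_pos hz
  have e2 := sq_mul_vEx_sq hz
  have hq : 0 < vEx z ^ 2 + (z 1) ^ 2 := by positivity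
  have h1 : 0 ≤ 1 - vEx z ^ 2 := by
    by_contra! h
    nlinarith [mul_pos (neg_pos.2 h) hq, sq_nonneg (z 0 * vEx z)]
  have h2 : vEx z ≤ 1 := by nlinarith
  refine ⟨by linarith, ?_⟩
  have h3 : 1 - vEx z ^ 2 ≤ (z 0) ^ 2 := by
    by_contra! h
    nlinarith [mul_pos (sub_pos.2 h) (pow_pos hv0 2), mul_nonneg h1 (sq_nonneg (z 1))]
  nlinarith

lemma abs_uEx_le {z : E2} (hz : z ∈ ball (0 : E2) 1) : |uEx z| ≤ (z 0) ^ 2 := by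
  have h := one_sub_vEx_mem_Icc hz
  change |if 0 ≤ z 0 then 1 - vEx z else -1 + vEx z| ≤ _
  rw [abs_le]
  split_ifs <;> constructor <;> linarith [h.1, h.2]

lemma hasGradientAt_vEx {z : E2} (hz : z ∈ ball (0 : E2) 1) :
    HasGradientAt vEx (-(z 0) • hEx z) z := by
  have hd0 := dEx_pos hz
  have hv0 := vEx_pos hz
  have e2 := sq_mul_vEx_sq hz
  have hq : 0 < vEx z ^ 2 + (z 1) ^ 2 := by positivity
  rw [hasGradientAt_iff_hasFDerivAt, toDual_smul_hEx]
  refine (hasFDerivAt_vEx hz).congr_fderiv ?_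
  congr 2
  · ring
  · field_simp
    linear_combination -(z 1) * e2

lemma hasGradientAt_uEx {z : E2} (hz : z ∈ ball (0 : E2) 1) :
    HasGradientAt uEx (|z 0| • hEx z) z := by
  rcases lt_trichotomy (z 0) 0 with hx | hx | hx
  · rw [abs_of_neg hx]
    have h := hasGradientAt_vEx hz
    rw [hasGradientAt_iff_hasFDerivAt] at h ⊢
    refine (h.const_add (-1)).congr_of_eventuallyEq ?_
    have hc : ∀ᶠ y : E2 in 𝓝 z, y 0 < 0 :=
      ContinuousAt.eventually_lt (by fun_prop) continuousAt_const hx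
    filter_upwards [hc] with y hy
    exact if_neg hy.not_ge
  · rw [hx, abs_zero, zero_smul, hasGradientAt_iff_hasFDerivAt, map_zero]
    have hO : uEx =O[𝓝 z] fun y => ‖y - z‖ ^ 2 := by
      refine Asymptotics.IsBigO.of_bound 1 ?_
      filter_upwards [isOpen_ball.mem_nhds hz] with y hy
      rw [one_mul, norm_pow, norm_norm, Real.norm_eq_abs]
      refine (abs_uEx_le hy).trans ?_
      have h := PiLp.norm_apply_le (y - z) 0
      simp only [PiLp.sub_apply, hx, sub_zero] at h
      rw [← sq_abs]
      exact pow_le_pow_left₀ (abs_nonneg _) h 2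
    exact hO.hasFDerivAt one_lt_two
  · rw [abs_of_pos hx]
    have h := hasGradientAt_vEx hz
    rw [hasGradientAt_iff_hasFDerivAt] at h ⊢
    have h2 := h.const_sub 1
    rw [← map_neg, neg_smul, neg_neg] at h2
    refine h2.congr_of_eventuallyEq ?_
    have hc : ∀ᶠ y : E2 in 𝓝 z, 0 < y 0 :=
      ContinuousAt.eventually_lt continuousAt_const (by fun_prop) hx
    filter_upwards [hc] with y hy
    exact if_pos hy.le

lemma fluxEx_eq {z : E2} (hz : z ∈ ball (0 : E2) 1) {φ : E2 → ℝ} (hx : z 0 ≠ 0) :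
    (if gradient uEx z = 0 then 0 else
      √(1 + ‖gradient uEx z‖ ^ 2) * ⟪(‖gradient uEx z‖)⁻¹ • gradient uEx z, gradient φ z⟫)
    = fderiv ℝ wEx z !₂[0, 1] * fderiv ℝ φ z !₂[1, 0]
      - fderiv ℝ wEx z !₂[1, 0] * fderiv ℝ φ z !₂[0, 1] := by
  have hd0 := dEx_pos hz
  have hv0 := vEx_pos hz
  have hq : 0 < vEx z ^ 2 + (z 1) ^ 2 := by positivity
  have hn : 0 < ‖hEx z‖ := norm_pos_iff.2 (hEx_ne_zero hz)
  have ha : 0 < |z 0| := abs_pos.2 hx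
  rw [(hasGradientAt_uEx hz).gradient, if_neg (smul_ne_zero ha.ne' (hEx_ne_zero hz)), norm_smul,
    Real.norm_eq_abs, abs_abs, sqrt_one_add_sq_mul_norm_sq_hEx hz, smul_smul, real_inner_smul_left,
    real_inner_comm, ← InnerProductSpace.toDual_apply_apply (𝕜 := ℝ), toDual_gradient,
    (hasFDerivAt_wEx hz).fderiv]
  have hh : hEx z = (vEx z / dEx z) • !₂[1, 0]
      + (-(vEx z * (z 0) * (z 1)) / (dEx z * (vEx z ^ 2 + (z 1) ^ 2))) • !₂[0, 1] := by
    ext i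
    fin_cases i <;> simp [hEx]
  have hf : fderiv ℝ φ z (hEx z) = (vEx z / dEx z) * fderiv ℝ φ z !₂[1, 0]
      + (-(vEx z * (z 0) * (z 1)) / (dEx z * (vEx z ^ 2 + (z 1) ^ 2))) *
        fderiv ℝ φ z !₂[0, 1] := by
    conv_lhs => rw [hh, map_add, map_smul, map_smul, smul_eq_mul, smul_eq_mul]
  rw [hf]
  simp
  field_simp
  ring

lemma volume_setOf_coord_eq_zero : volume {z : E2 | z 0 = 0} = 0 := by
  refine Measure.addHaar_submodule volume
    (EuclideanSpace.proj (0 : Fin 2) : E2 →L[ℝ] ℝ).ker fun h => ?_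
  have h1 : (!₂[1, 0] : E2) ∈ (EuclideanSpace.proj (0 : Fin 2) : E2 →L[ℝ] ℝ).ker := by
    rw [h]
    trivial
  simp at h1

/-- On every ball `B(0,R)`, `0 < R < 1`, the explicit function `uEx` is
`C^{1,1}` (continuously differentiable with Lipschitz gradient), its critical set has zero
Lebesgue measure, and it is a weak solution of `div(√(1+‖∇u‖²)·∇u/‖∇u‖) = 0`. -/
theorem explicit_example
    (R : ℝ) (hR0 : 0 < R) (hR1 : R < 1) :
    (ContDiffOn ℝ 1 uEx (ball (0:E2) R) ∧
      ∃ L : NNReal, LipschitzOnWith L (fun z => gradient uEx z) (ball (0:E2) R)) ∧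
    volume {z ∈ ball (0:E2) R | gradient uEx z = 0} = 0 ∧
    WeakSol (fun ρ => Real.sqrt (1 + ρ ^ 2)) (ball (0:E2) R) uEx := by
  have hsub : closedBall (0 : E2) R ⊆ ball 0 1 := closedBall_subset_ball hR1
  have hsub' : ball (0 : E2) R ⊆ ball 0 1 := ball_subset_ball hR1.le
  have hh : ContDiffOn ℝ 1 hEx (ball 0 1) := fun z hz => (contDiffAt_hEx hz).contDiffWithinAt
  have hgrad : EqOn (gradient uEx) (fun z => |z 0| • hEx z) (ball 0 1) :=
    fun z hz => (hasGradientAt_uEx hz).gradient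
  refine ⟨⟨?_, ?_⟩, ?_, ?_⟩
  · refine ContDiffOn.mono ?_ hsub'
    rw [← zero_add (1 : WithTop ℕ∞), contDiffOn_succ_iff_fderiv_of_isOpen isOpen_ball]
    refine ⟨fun z hz => (hasGradientAt_uEx hz).differentiableAt.differentiableWithinAt,
      by simp, contDiffOn_zero.2 ?_⟩
    rw [← toDual_comp_gradient]
    refine (InnerProductSpace.toDual ℝ E2).continuous.comp_continuousOn
      (ContinuousOn.congr ?_ hgrad)
    exact ContinuousOn.smul (f := fun z : E2 => |z 0|) (by fun_prop) hh.continuousOn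
  · have hK := isCompact_closedBall (0 : E2) R
    obtain ⟨L, hL⟩ := hh.exists_lipschitzOnWith_of_convex_isCompact isOpen_ball hK
      (convex_closedBall 0 R) hsub
    obtain ⟨B, hB⟩ := hK.exists_bound_of_continuousOn (hh.continuousOn.mono hsub)
    have hx : LipschitzWith 1 fun z : E2 => |z 0| := LipschitzWith.of_dist_le_mul fun x y => by
      rw [NNReal.coe_one, one_mul, Real.dist_eq, dist_eq_norm]
      exact (abs_abs_sub_abs_le _ _).trans (PiLp.norm_apply_le (x - y) 0)
    have hA : ∀ z ∈ closedBall (0 : E2) R, ‖|z 0|‖ ≤ R.toNNReal := fun z hz => by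
      rw [Real.norm_eq_abs, abs_abs]
      exact (PiLp.norm_apply_le z 0).trans
        ((mem_closedBall_zero_iff.1 hz).trans (Real.le_coe_toNNReal R))
    have h := (hx.lipschitzOnWith (s := closedBall 0 R)).smul_of_norm_le hL hA
      fun z hz => (hB z hz).trans (Real.le_coe_toNNReal B)
    refine ⟨R.toNNReal * L + 1 * B.toNNReal, fun x hx y hy => ?_⟩
    simpa only [hgrad (hsub' hx), hgrad (hsub' hy)] using
      h (ball_subset_closedBall hx) (ball_subset_closedBall hy)
  · refine measure_mono_null (fun z hz => ?_) volume_setOf_coord_eq_zero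
    have h := hz.2
    rw [hgrad (hsub' hz.1)] at h
    exact abs_eq_zero.1 ((smul_eq_zero.1 h).resolve_right (hEx_ne_zero (hsub' hz.1)))
  · intro φ hφ hφc hφR
    have hw : ContDiffOn ℝ 1 wEx (ball 0 1) := fun z hz => (contDiffAt_wEx hz).contDiffWithinAt
    have hdiv := integral_fderiv_mul_fderiv_sub_eq_zero (μ := volume) isOpen_ball hw
      (contDiff_infty.1 hφ 2) hφc (hφR.trans hsub') !₂[0, 1] !₂[1, 0]
    rw [← setIntegral_eq_integral_of_forall_compl_eq_zero (s := ball (0 : E2) R)] at hdiv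
    · refine (setIntegral_congr_ae measurableSet_ball ?_).trans hdiv
      have hx : ∀ᵐ z : E2, z 0 ≠ 0 := measure_eq_zero_iff_ae_notMem.1 volume_setOf_coord_eq_zero
      filter_upwards [hx] with z hz hzR
      exact fluxEx_eq (hsub' hzR) hz
    · intro z hz
      have h0 : fderiv ℝ φ z = 0 := by
        by_contra h
        exact hz (hφR (support_fderiv_subset ℝ h))
      simp [h0]
end
end
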